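/- arXiv:math/0611698 — 6 statements merged into one kernel-verified Lean document; each statement's English description precedes it below -/
import Mathlib

section
/- For every n ≥ 1, the map P ↦ c(P) is a bijection from the set of nonempty DUU-avoiding Dyck n-paths onto the set of compositions of n; moreover, such a path P is primitive if and only if the last part of c(P) equals 1. -/
namespace Paper

/-- A step of a lattice path: `true` is an upstep `U`, `false` is a downstep `D`. -/
abbrev Step := Bool

def U : Step := true
def D : Step := false

/-- `p` is a Dyck path: equally many `U`s and `D`s, and every prefix has at
least as many `U`s as `D`s. -/
def IsDyck (p : List Step) : Prop :=
  p.count U = p.count D ∧ ∀ n : ℕ, (p.take n).count D ≤ (p.take n).count U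

/-- `p` is a primitive Dyck path: it is a nonempty Dyck path and every proper
nonempty prefix has strictly more `U`s than `D`s. -/
def IsPrim (p : List Step) : Prop :=
  IsDyck p ∧ p ≠ [] ∧
    ∀ n : ℕ, 0 < n → n < p.length → (p.take n).count D < (p.take n).count U

/-- `U^i`. -/
def Us (i : ℕ) : List Step := List.replicate i U

/-- `D^i`. -/
def Ds (i : ℕ) : List Step := List.replicate i D

/-- `(UD)^i`. -/
def UDs (i : ℕ) : List Step := (List.replicate i [U, D]).flatten

/-- `p` ends with `DD`. -/
def EndsDD (p : List Step) : Prop := ∃ q, p = q ++ [D, D]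

/-- The number of occurrences of the word `w` as a contiguous substring of `p`. -/
def numOccs (w p : List Step) : ℕ :=
  ((List.range p.length).filter (fun j => decide ((p.drop j).take w.length = w))).length

/-- The height of the vertex of `p` reached after `k` steps. -/
def hgt (p : List Step) (k : ℕ) : ℕ := (p.take k).count U - (p.take k).count D

/-- The height of the path `p`: the maximal vertex height. -/
def pathHeight (p : List Step) : ℕ :=
  ((List.range (p.length + 1)).map (hgt p)).foldr max 0

/-- The composition `c(P) = (c_1, …, c_h)` associated with a nonempty
`DUU`-avoiding Dyck path of height `h`: `c_i` is the number of downsteps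
ending at height `h - i`. -/
def compOf (p : List Step) : List ℕ :=
  (List.range (pathHeight p)).map (fun i =>
    ((List.range p.length).filter (fun j =>
      decide (p.getD j U = D ∧ hgt p (j + 1) = pathHeight p - (i + 1)))).length)

theorem UDs_succ (i : ℕ) : UDs (i + 1) = U :: D :: UDs i := by
  simp [UDs, List.replicate_succ]

theorem Us_succ (i : ℕ) : Us (i + 1) = U :: Us i := List.replicate_succ

/-- The signed height change along a word. -/
def rise : List Step → ℤ
  | [] => 0
  | true :: l => 1 + rise l
  | false :: l => -1 + rise l

@[simp] theorem rise_nil : rise [] = 0 := rfl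
@[simp] theorem rise_U (l : List Step) : rise (U :: l) = 1 + rise l := rfl
@[simp] theorem rise_D (l : List Step) : rise (D :: l) = -1 + rise l := rfl

theorem rise_eq_count (l : List Step) : rise l = (l.count U : ℤ) - l.count D := by
  induction l with
  | nil => rfl
  | cons x l ih => cases x <;> simp [rise, ih, U, D] <;> ring

theorem rise_append (l m : List Step) : rise (l ++ m) = rise l + rise m := by
  simp only [rise_eq_count, List.count_append]
  push_cast
  ring

/-- All vertices of the word `l` started at height `s` have a height satisfying `Q`. -/
def AllHeights (Q : ℤ → Prop) : ℤ → List Step → Prop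
  | s, [] => Q s
  | s, true :: l => Q s ∧ AllHeights Q (s + 1) l
  | s, false :: l => Q s ∧ AllHeights Q (s - 1) l

@[simp] theorem allHeights_nil (Q : ℤ → Prop) (s : ℤ) : AllHeights Q s [] ↔ Q s := Iff.rfl
@[simp] theorem allHeights_U (Q : ℤ → Prop) (s : ℤ) (l : List Step) :
    AllHeights Q s (U :: l) ↔ Q s ∧ AllHeights Q (s + 1) l := Iff.rfl
@[simp] theorem allHeights_D (Q : ℤ → Prop) (s : ℤ) (l : List Step) :
    AllHeights Q s (D :: l) ↔ Q s ∧ AllHeights Q (s - 1) l := Iff.rfl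

theorem AllHeights.start {Q : ℤ → Prop} {s : ℤ} {l : List Step} (h : AllHeights Q s l) : Q s := by
  cases l with
  | nil => exact h
  | cons x l => cases x <;> exact h.1

theorem allHeights_iff (Q : ℤ → Prop) (s : ℤ) (l : List Step) :
    AllHeights Q s l ↔ ∀ k, Q (s + rise (l.take k)) := by
  induction l generalizing s with
  | nil => simp
  | cons x l ih =>
    constructor
    · intro h k
      cases k with
      | zero => simpa using h.start
      | succ k =>
        cases x
        · have := (ih _).1 h.2 k
          simpa [rise, ← add_assoc, sub_eq_add_neg] using this
        · have := (ih _).1 h.2 k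
          simpa [rise, ← add_assoc] using this
    · intro h
      cases x
      · refine ⟨by simpa using h 0, (ih _).2 fun k => ?_⟩
        simpa [rise, ← add_assoc, sub_eq_add_neg] using h (k + 1)
      · refine ⟨by simpa using h 0, (ih _).2 fun k => ?_⟩
        simpa [rise, ← add_assoc] using h (k + 1)

theorem allHeights_Us_append (Q : ℤ → Prop) (s : ℤ) (h : ℕ) (l : List Step)
    (hQ : ∀ i : ℕ, i < h → Q (s + i)) (hl : AllHeights Q (s + h) l) :
    AllHeights Q s (Us h ++ l) := by
  induction h generalizing s with
  | zero => simpa [Us] using hl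
  | succ h ih =>
    rw [Us_succ, List.cons_append, allHeights_U]
    refine ⟨by simpa using hQ 0 (by omega), ih _ (fun i hi => ?_) ?_⟩
    · have := hQ (i + 1) (by omega)
      push_cast at this
      rwa [add_assoc, add_comm (1 : ℤ)]
    · push_cast at hl
      rwa [add_assoc, add_comm (1 : ℤ)]

theorem allHeights_UDs_append (Q : ℤ → Prop) (s : ℤ) (a : ℕ) (l : List Step)
    (hQ : Q (s + 1)) (hl : AllHeights Q s l) : AllHeights Q s (UDs a ++ l) := by
  induction a with
  | zero => simpa [UDs] using hl
  | succ a ih => simpa [UDs_succ, hQ, hl.start] using ih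

theorem isDyck_iff (p : List Step) : IsDyck p ↔ rise p = 0 ∧ AllHeights (0 ≤ ·) 0 p := by
  rw [IsDyck, allHeights_iff]
  simp only [rise_eq_count, zero_add]
  constructor
  · rintro ⟨h1, h2⟩
    refine ⟨by omega, fun k => ?_⟩
    have := h2 k
    omega
  · rintro ⟨h1, h2⟩
    refine ⟨by omega, fun k => ?_⟩
    have := h2 k
    omega

/-- The word `D (UD)^(c_1 - 1) D (UD)^(c_2 - 1) ⋯`. -/
def descent : List ℕ → List Step
  | [] => []
  | a :: c => D :: (UDs (a - 1) ++ descent c)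

/-- The `DUU`-avoiding Dyck path whose associated composition is `c`. -/
def pathOf (c : List ℕ) : List Step := Us c.length ++ descent c

theorem descent_append (c d : List ℕ) : descent (c ++ d) = descent c ++ descent d := by
  induction c with
  | nil => rfl
  | cons a c ih => simp [descent, ih]

theorem rise_Us (h : ℕ) : rise (Us h) = h := by
  induction h with
  | zero => rfl
  | succ h ih => rw [Us_succ, rise_U, ih]; push_cast; ring

theorem rise_UDs (a : ℕ) : rise (UDs a) = 0 := by
  induction a with
  | zero => rfl
  | succ a ih => rw [UDs_succ, rise_U, rise_D, ih]; ring

theorem rise_descent (c : List ℕ) : rise (descent c) = -c.length := by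
  induction c with
  | nil => rfl
  | cons a c ih =>
    simp only [descent, rise_D, rise_append, rise_UDs, ih, List.length_cons]
    push_cast
    ring

theorem allHeights_descent (Q : ℤ → Prop) (s : ℤ) (c : List ℕ)
    (hQ : ∀ i : ℕ, i ≤ c.length → Q (s - i)) : AllHeights Q s (descent c) := by
  induction c generalizing s with
  | nil => simpa [descent] using hQ 0
  | cons a c ih =>
    have h0 : Q s := by simpa using hQ 0
    rw [descent, allHeights_D]
    refine ⟨h0, allHeights_UDs_append _ _ _ _ (by simpa using h0) (ih _ fun i hi => ?_)⟩
    have := hQ (i + 1) (by simpa using hi)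
    push_cast at this
    rwa [sub_sub, add_comm (1 : ℤ)]

theorem rise_pathOf (c : List ℕ) : rise (pathOf c) = 0 := by
  rw [pathOf, rise_append, rise_Us, rise_descent]
  ring

theorem isDyck_pathOf (c : List ℕ) : IsDyck (pathOf c) := by
  rw [isDyck_iff]
  refine ⟨rise_pathOf c, allHeights_Us_append _ _ _ _ (fun i _ => by omega) ?_⟩
  exact allHeights_descent _ _ _ fun i hi => by omega

theorem count_U_UDs (a : ℕ) : (UDs a).count U = a := by
  induction a with
  | zero => rfl
  | succ a ih => simp [UDs_succ, U, D] at ih ⊢; exact ih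

theorem count_U_descent (c : List ℕ) (hc : ∀ x ∈ c, 0 < x) :
    (descent c).count U + c.length = c.sum := by
  induction c with
  | nil => rfl
  | cons a c ih =>
    have ha := hc a (by simp)
    have := ih fun x hx => hc x (by simp [hx])
    have hD : (D :: (UDs (a - 1) ++ descent c)).count U
        = (UDs (a - 1)).count U + (descent c).count U := by
      rw [List.count_cons_of_ne (by decide), List.count_append]
    rw [descent, hD, count_U_UDs, List.length_cons, List.sum_cons]
    omega

theorem count_U_pathOf (c : List ℕ) (hc : ∀ x ∈ c, 0 < x) : (pathOf c).count U = c.sum := by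
  rw [pathOf, List.count_append, ← count_U_descent c hc, Us, List.count_replicate_self, add_comm]

theorem numOccs_eq_zero_iff (w p : List Step) (hw : w ≠ []) :
    numOccs w p = 0 ↔ ¬ w <:+: p := by
  simp only [numOccs, List.length_eq_zero_iff, List.filter_eq_nil_iff, List.mem_range,
    decide_eq_true_eq]
  constructor
  · rintro h ⟨s, t, rfl⟩
    refine h s.length ?_ (by simp)
    have := List.length_pos_iff.2 hw
    simp only [List.length_append]
    omega
  · intro h j _ hj
    apply h
    rw [← hj]
    exact (List.take_prefix _ _).isInfix.trans (List.drop_suffix _ _).isInfix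

theorem not_DUU_infix_descent (c : List ℕ) :
    ¬ [D, U, U] <:+: descent c ∧ ¬ [U, U] <+: descent c := by
  have cons_D : ∀ l : List Step, (¬ [D, U, U] <:+: l ∧ ¬ [U, U] <+: l) →
      (¬ [D, U, U] <:+: D :: l ∧ ¬ [U, U] <+: D :: l) := by
    intro l hl
    simp only [List.infix_cons_iff, List.cons_prefix_cons] at hl ⊢
    simpa [U, D, and_comm] using hl
  induction c with
  | nil => simp [descent]
  | cons a c ih =>
    refine cons_D _ ?_
    generalize a - 1 = b
    induction b with
    | zero => simpa [UDs] using ih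
    | succ b ihb =>
      have := cons_D _ ihb
      rw [UDs_succ, List.cons_append, List.cons_append, List.infix_cons_iff (a := U)]
      simp only [List.cons_prefix_cons]
      simpa [U, D] using this.1

theorem numOccs_pathOf (c : List ℕ) : numOccs [D, U, U] (pathOf c) = 0 := by
  rw [numOccs_eq_zero_iff _ _ (by simp), pathOf]
  generalize c.length = h
  induction h with
  | zero => simpa [Us] using (not_DUU_infix_descent c).1
  | succ h ih =>
    rw [Us_succ, List.cons_append, List.infix_cons_iff, List.cons_prefix_cons]
    simpa [U, D] using ih

theorem exists_descent_eq (l : List Step) (s : ℤ) (hl : ¬ [D, U, U] <:+: D :: l)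
    (hs : AllHeights (0 ≤ ·) s l) (h0 : s + rise l = 0) :
    ∃ (a : ℕ) (c : List ℕ), l = UDs a ++ descent c ∧ (∀ x ∈ c, 0 < x) ∧ (c.length : ℤ) = s := by
  match l with
  | [] => exact ⟨0, [], rfl, by simp, by simpa using h0.symm⟩
  | false :: l =>
    obtain ⟨a, c, rfl, hc, hlen⟩ := exists_descent_eq l (s - 1)
      (fun h => hl (h.trans (List.suffix_cons _ _).isInfix)) hs.2
      (by simp only [rise] at h0; omega)
    refine ⟨0, (a + 1) :: c, rfl, ?_, by rw [List.length_cons]; push_cast; omega⟩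
    intro x hx
    rcases List.mem_cons.1 hx with rfl | hx
    · omega
    · exact hc x hx
  | [true] =>
    have := hs.start
    simp only [rise] at h0
    omega
  | true :: true :: l => exact absurd ⟨[], l, rfl⟩ hl
  | true :: false :: l =>
    obtain ⟨a, c, rfl, hc, hlen⟩ := exists_descent_eq l s
      (fun h => hl (h.trans ((List.suffix_cons _ _).trans (List.suffix_cons _ _)).isInfix))
      (by simpa using hs.2.2) (by simp only [rise] at h0; omega)
    exact ⟨a + 1, c, by rw [UDs_succ]; rfl, hc, hlen⟩

theorem exists_Us_append (p : List Step) : ∃ h : ℕ, p = Us h ∨ ∃ l, p = Us h ++ D :: l := by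
  induction p with
  | nil => exact ⟨0, Or.inl rfl⟩
  | cons x p ih =>
    cases x
    · exact ⟨0, Or.inr ⟨p, rfl⟩⟩
    · obtain ⟨h, rfl | ⟨l, rfl⟩⟩ := ih
      · exact ⟨h + 1, Or.inl rfl⟩
      · exact ⟨h + 1, Or.inr ⟨l, rfl⟩⟩

theorem AllHeights.of_append {Q : ℤ → Prop} {s : ℤ} {l m : List Step}
    (h : AllHeights Q s (l ++ m)) : AllHeights Q (s + rise l) m := by
  rw [allHeights_iff] at h ⊢
  intro k
  have := h (l.length + k)
  rwa [List.take_length_add_append, rise_append, ← add_assoc] at this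

theorem exists_pathOf_eq (p : List Step) (hp : IsDyck p) (hne : p ≠ [])
    (hocc : numOccs [D, U, U] p = 0) : ∃ c, (∀ x ∈ c, 0 < x) ∧ c ≠ [] ∧ p = pathOf c := by
  rw [numOccs_eq_zero_iff _ _ (by simp)] at hocc
  obtain ⟨h0, hpos⟩ := (isDyck_iff p).1 hp
  obtain ⟨h, rfl | ⟨l, rfl⟩⟩ := exists_Us_append p
  · rw [rise_Us] at h0
    obtain rfl : h = 0 := by omega
    exact absurd rfl hne
  · have hl := hpos.of_append
    rw [rise_Us, allHeights_D] at hl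
    rw [rise_append, rise_Us, rise_D] at h0
    obtain ⟨a, c, rfl, hc, hlen⟩ := exists_descent_eq l _
      (fun h => hocc (h.trans (List.suffix_append _ _).isInfix)) hl.2 (by omega)
    refine ⟨(a + 1) :: c, ?_, by simp, ?_⟩
    · intro x hx
      rcases List.mem_cons.1 hx with rfl | hx
      · omega
      · exact hc x hx
    · have : h = c.length + 1 := by omega
      rw [pathOf, descent, List.length_cons, this, Nat.add_sub_cancel]

theorem hgt_cast (p : List Step) (hp : IsDyck p) (k : ℕ) : (hgt p k : ℤ) = rise (p.take k) := by
  have := hp.2 k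
  rw [hgt, rise_eq_count]
  omega

theorem pathHeight_pathOf (c : List ℕ) : pathHeight (pathOf c) = c.length := by
  have hd := isDyck_pathOf c
  apply le_antisymm
  · refine List.max_le_of_forall_le _ _ fun x hx => ?_
    obtain ⟨k, -, rfl⟩ := List.mem_map.1 hx
    have : AllHeights (· ≤ (c.length : ℤ)) 0 (pathOf c) :=
      allHeights_Us_append _ _ _ _ (fun i _ => by omega)
        (allHeights_descent _ _ _ fun i hi => by omega)
    have := (allHeights_iff _ _ _).1 this k
    have := hgt_cast _ hd k
    omega
  · have h := hgt_cast _ hd c.length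
    have hlen : (Us c.length).length = c.length := List.length_replicate
    have htake : (pathOf c).take c.length = Us c.length := by
      rw [pathOf, List.take_left' hlen]
    rw [htake, rise_Us] at h
    refine List.le_max_of_le (List.mem_map.2 ⟨c.length, ?_, rfl⟩) (by omega)
    rw [List.mem_range, pathOf, List.length_append, hlen]
    omega

/-- The number of downsteps ending at height `v`, in the word `l` started at height `s`. -/
def downsTo (v : ℤ) : ℤ → List Step → ℕ
  | _, [] => 0
  | s, true :: l => downsTo v (s + 1) l
  | s, false :: l => (if s - 1 = v then 1 else 0) + downsTo v (s - 1) l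

@[simp] theorem downsTo_U (v s : ℤ) (l : List Step) :
    downsTo v s (U :: l) = downsTo v (s + 1) l := rfl
@[simp] theorem downsTo_D (v s : ℤ) (l : List Step) :
    downsTo v s (D :: l) = (if s - 1 = v then 1 else 0) + downsTo v (s - 1) l := rfl

theorem length_filter_eq_downsTo (v s : ℤ) (l : List Step) :
    ((List.range l.length).filter fun j =>
      decide (l.getD j U = D ∧ s + rise (l.take (j + 1)) = v)).length = downsTo v s l := by
  induction l generalizing s with
  | nil => rfl
  | cons x l ih =>
    rw [List.length_cons, List.range_succ_eq_map, List.filter_cons, List.filter_map]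
    cases x
    · have e : ∀ r : ℤ, s + (-1 + r) = s - 1 + r := fun r => by ring
      simp only [downsTo, ← ih, Function.comp_def, List.getD_cons_succ, List.take_succ_cons,
        rise, List.getD_cons_zero, List.take_zero, Nat.succ_eq_add_one, e]
      by_cases hv : s - 1 = v
      · simp [hv, D, add_comm]
      · simp [hv, D]
    · simp only [downsTo, ← ih, Function.comp_def, List.getD_cons_succ, List.take_succ_cons,
        rise, List.getD_cons_zero, List.take_zero, Nat.succ_eq_add_one, ← add_assoc]
      simp [D]

theorem downsTo_Us_append (v s : ℤ) (h : ℕ) (l : List Step) :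
    downsTo v s (Us h ++ l) = downsTo v (s + h) l := by
  induction h generalizing s with
  | zero => simp [Us]
  | succ h ih =>
    rw [Us_succ, List.cons_append, downsTo_U, ih]
    push_cast
    congr 1
    ring

theorem downsTo_UDs_append (v s : ℤ) (a : ℕ) (l : List Step) :
    downsTo v s (UDs a ++ l) = (if s = v then a else 0) + downsTo v s l := by
  induction a with
  | zero => simp [UDs]
  | succ a ih =>
    rw [UDs_succ, List.cons_append, List.cons_append, downsTo_U, downsTo_D, add_sub_cancel_right,
      ih]
    split_ifs <;> omega

theorem downsTo_descent_cons (v s : ℤ) (a : ℕ) (ha : 0 < a) (c : List ℕ) :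
    downsTo v s (descent (a :: c)) =
      (if s - 1 = v then a else 0) + downsTo v (s - 1) (descent c) := by
  rw [descent, downsTo_D, downsTo_UDs_append]
  split_ifs <;> omega

theorem downsTo_descent_of_le (v s : ℤ) (c : List ℕ) (hc : ∀ x ∈ c, 0 < x) (hv : s ≤ v) :
    downsTo v s (descent c) = 0 := by
  induction c generalizing s with
  | nil => rfl
  | cons a c ih =>
    rw [downsTo_descent_cons _ _ _ (hc a (by simp)),
      ih _ (fun x hx => hc x (by simp [hx])) (by omega), if_neg (by omega)]

theorem downsTo_descent (s : ℤ) (c : List ℕ) (hc : ∀ x ∈ c, 0 < x) (i : ℕ) (hi : i < c.length) :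
    downsTo (s - (i + 1)) s (descent c) = (c)[i] := by
  induction c generalizing s i with
  | nil => simp at hi
  | cons a c ih =>
    have hc' : ∀ x ∈ c, 0 < x := fun x hx => hc x (by simp [hx])
    rw [downsTo_descent_cons _ _ _ (hc a (by simp))]
    cases i with
    | zero => simp [downsTo_descent_of_le _ _ c hc' le_rfl]
    | succ i =>
      rw [if_neg (by push_cast; omega), zero_add, List.getElem_cons_succ,
        ← ih (s - 1) hc' i (by simpa using hi)]
      congr 1
      push_cast
      ring

theorem compOf_pathOf (c : List ℕ) (hc : ∀ x ∈ c, 0 < x) : compOf (pathOf c) = c := by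
  apply List.ext_getElem
  · simp [compOf, pathHeight_pathOf]
  · intro i h1 h2
    have key := downsTo_descent c.length c hc i h2
    have := downsTo_Us_append (c.length - (i + 1)) 0 c.length (descent c)
    rw [zero_add, key, ← length_filter_eq_downsTo] at this
    simp only [compOf, List.getElem_map, List.getElem_range, pathHeight_pathOf]
    rw [← this, ← pathOf]
    congr 1
    refine List.filter_congr fun j _ => ?_
    have := hgt_cast _ (isDyck_pathOf c) (j + 1)
    rw [decide_eq_decide]
    refine and_congr_right fun _ => ?_
    omega

theorem pathOf_ne_nil (c : List ℕ) (h : c ≠ []) : pathOf c ≠ [] := by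
  cases c with
  | nil => exact absurd rfl h
  | cons a c => simp [pathOf, Us_succ]

theorem isPrim_iff (p : List Step) :
    IsPrim p ↔ IsDyck p ∧ p ≠ [] ∧ ∀ n : ℕ, 0 < n → n < p.length → 0 < rise (p.take n) := by
  simp only [IsPrim, rise_eq_count, sub_pos, Nat.cast_lt]

theorem isPrim_pathOf_iff (c : List ℕ) (hc : ∀ x ∈ c, 0 < x) (hne : c ≠ []) :
    IsPrim (pathOf c) ↔ c.getLast? = some 1 := by
  rw [isPrim_iff]
  obtain ⟨c, a, rfl⟩ : ∃ d a, c = d ++ [a] := ⟨_, _, (List.dropLast_append_getLast hne).symm⟩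
  have ha : 0 < a := hc a (by simp)
  rw [List.getLast?_append_of_ne_nil _ (by simp)]
  simp only [List.getLast?_singleton, Option.some.injEq]
  have hpath : pathOf (c ++ [a]) = Us (c.length + 1) ++ descent c ++ D :: UDs (a - 1) := by
    simp [pathOf, descent_append, descent]
  constructor
  · rintro ⟨-, -, h⟩
    by_contra hne1
    obtain ⟨b, rfl⟩ : ∃ b, a = b + 2 := ⟨a - 2, by omega⟩
    have hsplit : pathOf (c ++ [b + 2])
        = (Us (c.length + 1) ++ descent c ++ [D]) ++ UDs (b + 1) := by
      rw [hpath]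
      simp
    have := h (Us (c.length + 1) ++ descent c ++ [D]).length (by simp)
      (by rw [hsplit, List.length_append]; simp [UDs_succ]; omega)
    rw [hsplit, List.take_left, rise_append, rise_append, rise_Us, rise_descent] at this
    simp at this
  · rintro rfl
    refine ⟨isDyck_pathOf _, pathOf_ne_nil _ hne, fun k hk0 hk => ?_⟩
    have hsplit : pathOf (c ++ [1]) = U :: (Us c.length ++ descent c) ++ [D] := by
      rw [hpath, Us_succ]
      rfl
    rw [hsplit] at hk ⊢
    rw [List.take_append_of_le_length (by
      rw [List.length_append, List.length_singleton] at hk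
      omega)]
    obtain ⟨k, rfl⟩ : ∃ j, k = j + 1 := ⟨k - 1, by omega⟩
    have : AllHeights (0 < ·) 1 (Us c.length ++ descent c) :=
      allHeights_Us_append _ _ _ _ (fun i _ => by omega)
        (allHeights_descent _ _ _ fun i hi => by omega)
    exact (allHeights_iff _ _ _).1 this k

/-- For every `n ≥ 1`, `P ↦ c(P)` is a bijection from the set
of nonempty `DUU`-avoiding Dyck `n`-paths onto the set of compositions of `n`;
moreover such a path is primitive iff the last part of `c(P)` equals `1`. -/
theorem stmt_2 (n : ℕ) (hn : 1 ≤ n) :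
    Set.BijOn compOf
      {p : List Step | IsDyck p ∧ p ≠ [] ∧ numOccs [D, U, U] p = 0 ∧ p.count U = n}
      {c : List ℕ | (∀ x ∈ c, 0 < x) ∧ c.sum = n} ∧
    (∀ p : List Step, IsDyck p → p ≠ [] → numOccs [D, U, U] p = 0 → p.count U = n →
      (IsPrim p ↔ (compOf p).getLast? = some 1)) := by
  refine ⟨⟨?_, ?_, ?_⟩, ?_⟩
  · rintro p ⟨hp, hne, hocc, hcount⟩
    obtain ⟨c, hc, -, rfl⟩ := exists_pathOf_eq p hp hne hocc
    rw [compOf_pathOf c hc]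
    exact ⟨hc, by rw [← count_U_pathOf c hc, hcount]⟩
  · rintro p ⟨hp, hne, hocc, -⟩ q ⟨hq, hne', hocc', -⟩ h
    obtain ⟨c, hc, -, rfl⟩ := exists_pathOf_eq p hp hne hocc
    obtain ⟨d, hd, -, rfl⟩ := exists_pathOf_eq q hq hne' hocc'
    rw [compOf_pathOf c hc, compOf_pathOf d hd] at h
    rw [h]
  · rintro c ⟨hc, hsum⟩
    have hne : c ≠ [] := by
      rintro rfl
      simp at hsum
      omega
    exact ⟨pathOf c, ⟨isDyck_pathOf c, pathOf_ne_nil c hne, numOccs_pathOf c,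
      by rw [count_U_pathOf c hc, hsum]⟩, compOf_pathOf c hc⟩
  · intro p hp hne hocc _
    obtain ⟨c, hc, hcne, rfl⟩ := exists_pathOf_eq p hp hne hocc
    rw [compOf_pathOf c hc]
    exact isPrim_pathOf_iff c hc hcne

end Paper
end

section
/- Let k ≥ 1. For every integer i with 0 ≤ i < 2^k − 1, the binomial coefficient C(i + 2^k, i + 1) is even, while the binomial coefficient C(2^{k+1} − 1, 2^k) is odd. -/
/-- The binomial coefficient `C(i + p^k, i + 1)` is divisible by `p` whenever `i + 1 < p^k`. -/
theorem Nat.Prime.dvd_choose_add_pow_succ {p : ℕ} (hp : p.Prime) {k i : ℕ} (hi : i + 1 < p ^ k) :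
    p ∣ (i + p ^ k).choose (i + 1) := by
  rw [Nat.add_choose_eq]
  refine Finset.dvd_sum fun ⟨a, b⟩ hab => ?_
  rw [Finset.HasAntidiagonal.mem_antidiagonal] at hab
  dsimp only at hab ⊢
  rcases eq_or_ne b 0 with rfl | hb
  · simp [Nat.choose_eq_zero_of_lt (show i < a by lia)]
  · exact (hp.dvd_choose_pow hb (by lia)).mul_left _

/-- The binomial coefficient `C(2^{k+1} - 1, 2^k)` is odd. -/
theorem Nat.odd_choose_two_pow_succ_sub_one (k : ℕ) :
    Odd ((2 ^ (k + 1) - 1).choose (2 ^ k)) := by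
  induction k with
  | zero => decide
  | succ k ih =>
    have hpos : 0 < 2 ^ (k + 1) := by positivity
    have hlucas := Choose.choose_modEq_choose_mod_mul_choose_div_nat
      (n := 2 ^ (k + 1 + 1) - 1) (k := 2 ^ (k + 1)) (p := 2)
    have hmod : 2 ^ (k + 1) % 2 = 0 := by lia
    have hdiv : 2 ^ (k + 1) / 2 = 2 ^ k := by lia
    have hdiv' : (2 ^ (k + 1 + 1) - 1) / 2 = 2 ^ (k + 1) - 1 := by lia
    rw [hmod, hdiv, hdiv', Nat.choose_zero_right, one_mul] at hlucas
    rw [Nat.odd_iff] at ih ⊢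
    exact Eq.trans hlucas ih

/-- For `k ≥ 1`: for every `i < 2^k - 1` the binomial
coefficient `C(i + 2^k, i + 1)` is even, while `C(2^{k+1} - 1, 2^k)` is odd. -/
theorem stmt_6 (k : ℕ) (hk : 1 ≤ k) :
    (∀ i : ℕ, i < 2 ^ k - 1 → Even (Nat.choose (i + 2 ^ k) (i + 1))) ∧
    Odd (Nat.choose (2 ^ (k + 1) - 1) (2 ^ k)) :=
  ⟨fun _ hi => even_iff_two_dvd.mpr (Nat.prime_two.dvd_choose_add_pow_succ (by lia)),
    Nat.odd_choose_two_pow_succ_sub_one k⟩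
end

section
/- For every n ≥ 1, the map Φ restricts to a bijection of C_n onto itself, and there exists k ≥ 0 such that for every c ∈ C_n the least positive integer m with Φ^m(c) = c equals 2^k; that is, all Φ-orbits on C_n have the same length, and this common length is a power of 2. -/
namespace Paper

/-- Helper for `Phi`, acting on the reversed composition after the first
(odd-position, kept) part has been emitted: the head part (at an odd position
`≥ 3` from the right in the original composition) gets incremented, the next
(even-position) part `y` is replaced by `y - 1` ones, and so on; if the list
runs out just after an even position, a `1` is emitted (this is the prepended
`1` of the original composition). -/
def phiCont : List ℕ → List ℕ
  | [] => [1]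
  | [z] => [z + 1]
  | z :: y :: rest => (z + 1) :: (List.replicate (y - 1) 1 ++ phiCont rest)

/-- `Phi` on the reversed composition: the part at position 1 (from the right)
is kept, the part `y` at position 2 is replaced by `y - 1` ones, and the rest is
handled by `phiCont`. -/
def phiRev : List ℕ → List ℕ
  | [] => []
  | [x] => [x]
  | x :: y :: rest => x :: (List.replicate (y - 1) 1 ++ phiCont rest)

/-- The map `Φ` on compositions: counting positions from the right end (the last
part has position 1), every part `x` at even position is replaced by `x - 1`
ones and its left neighbour is incremented, a new part `1` being prepended when
the even-position part is the leftmost part. -/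
def Phi (c : List ℕ) : List ℕ := (phiRev c.reverse).reverse

/-- `Cset n` is the set of compositions of `n` whose last part equals `1`. -/
def Cset (n : ℕ) : Set (List ℕ) :=
  {c | (∀ x ∈ c, 0 < x) ∧ c.sum = n ∧ c.getLast? = some 1}

open Polynomial

/-- The indicator word of the starts of the parts of a composition read left to right. -/
def startWord : List ℕ → List (ZMod 2)
  | [] => []
  | x :: l => 1 :: (List.replicate (x - 1) 0 ++ startWord l)

/-- The partial sums of a word, starting from `a` (which is itself not listed). -/
def partialSums (a : ZMod 2) : List (ZMod 2) → List (ZMod 2)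
  | [] => []
  | b :: l => (a + b) :: partialSums (a + b) l

/-- The composition with first part at least `c` which continues with the word `l`. -/
def ofStartWord (c : ℕ) : List (ZMod 2) → List ℕ
  | [] => [c]
  | b :: l => if b = 0 then ofStartWord (c + 1) l else c :: ofStartWord 1 l

/-- The polynomial whose coefficients are the letters of a word. -/
noncomputable def wordPoly : List (ZMod 2) → (ZMod 2)[X]
  | [] => 0
  | b :: l => C b + X * wordPoly l

/-- The part of `phiRev` following the kept first part. -/
def phiTail : List ℕ → List ℕ
  | [] => []
  | y :: rest => List.replicate (y - 1) 1 ++ phiCont rest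

theorem phiRev_cons (x : ℕ) (t : List ℕ) : phiRev (x :: t) = x :: phiTail t := by
  cases t <;> rfl

theorem length_startWord {l : List ℕ} (hl : ∀ x ∈ l, 0 < x) :
    (startWord l).length = l.sum := by
  induction l with
  | nil => rfl
  | cons x l ih =>
    have hx := hl x (by simp)
    simp [startWord, ih fun y hy => hl y (by simp [hy])]
    omega

theorem startWord_replicate_one_append (k : ℕ) (l : List ℕ) :
    startWord (List.replicate k 1 ++ l) = List.replicate k 1 ++ startWord l := by
  induction k with
  | zero => rfl
  | succ k ih => simp [List.replicate_succ, startWord, ih]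

theorem partialSums_replicate_zero_append (a : ZMod 2) (k : ℕ) (l : List (ZMod 2)) :
    partialSums a (List.replicate k 0 ++ l) = List.replicate k a ++ partialSums a l := by
  induction k with
  | zero => rfl
  | succ k ih => simp [List.replicate_succ, partialSums, ih]

theorem length_partialSums (a : ZMod 2) (l : List (ZMod 2)) :
    (partialSums a l).length = l.length := by
  induction l generalizing a with
  | nil => rfl
  | cons b l ih => simp [partialSums, ih]

theorem ofStartWord_replicate_zero_append (c k : ℕ) (l : List (ZMod 2)) :
    ofStartWord c (List.replicate k 0 ++ l) = ofStartWord (c + k) l := by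
  induction k generalizing c with
  | zero => rfl
  | succ k ih => simp [List.replicate_succ, ofStartWord, ih, add_assoc, add_comm 1 k]

theorem ofStartWord_startWord (c : ℕ) {l : List ℕ} (hl : ∀ x ∈ l, 0 < x) :
    ofStartWord c (startWord l) = c :: l := by
  induction l generalizing c with
  | nil => rfl
  | cons x l ih =>
    have hx := hl x (by simp)
    simp [startWord, ofStartWord, ofStartWord_replicate_zero_append,
      ih _ fun y hy => hl y (by simp [hy])]
    omega

theorem pos_of_mem_phiCont (l : List ℕ) : ∀ x ∈ phiCont l, 0 < x := by
  induction l using phiCont.induct with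
  | case1 => simp [phiCont]
  | case2 z => simp [phiCont]
  | case3 z y rest ih =>
    intro x hx
    simp only [phiCont, List.mem_cons, List.mem_append, List.mem_replicate] at hx
    rcases hx with rfl | ⟨-, rfl⟩ | hx
    · omega
    · omega
    · exact ih x hx

theorem pos_of_mem_phiTail (l : List ℕ) : ∀ x ∈ phiTail l, 0 < x := by
  cases l with
  | nil => simp [phiTail]
  | cons y rest =>
    intro x hx
    simp only [phiTail, List.mem_append, List.mem_replicate] at hx
    rcases hx with ⟨-, rfl⟩ | hx
    · omega
    · exact pos_of_mem_phiCont rest x hx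

theorem startWord_phiCont {l : List ℕ} (hl : ∀ x ∈ l, 0 < x) :
    startWord (phiCont l) = 1 :: partialSums 1 (startWord l) := by
  have h2 : (1 + 1 : ZMod 2) = 0 := rfl
  induction l using phiCont.induct with
  | case1 => simp [phiCont, startWord, partialSums]
  | case2 z =>
    obtain ⟨z, rfl⟩ := Nat.exists_eq_add_of_lt (hl z (by simp))
    have := partialSums_replicate_zero_append 0 z []
    simp_all [phiCont, startWord, partialSums, List.replicate_succ]
  | case3 z y rest ih =>
    obtain ⟨z, rfl⟩ := Nat.exists_eq_add_of_lt (hl z (by simp))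
    obtain ⟨y, rfl⟩ := Nat.exists_eq_add_of_lt (hl y (by simp))
    have ih := ih fun x hx => hl x (by simp [hx])
    simp [phiCont, startWord, partialSums, partialSums_replicate_zero_append, h2,
      startWord_replicate_one_append, ih, List.replicate_succ]
    rw [← List.cons_append, ← List.replicate_succ, List.replicate_succ']
    simp

theorem startWord_phiTail {l : List ℕ} (hl : ∀ x ∈ l, 0 < x) :
    startWord (phiTail l) = partialSums 0 (startWord l) := by
  cases l with
  | nil => rfl
  | cons y rest =>
    obtain ⟨y, rfl⟩ := Nat.exists_eq_add_of_lt (hl y (by simp))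
    have h := startWord_phiCont fun x hx => hl x (List.mem_cons_of_mem _ hx)
    simp [phiTail, startWord, partialSums, partialSums_replicate_zero_append,
      startWord_replicate_one_append, h]
    rw [← List.cons_append, ← List.replicate_succ, List.replicate_succ']
    simp

theorem X_pow_dvd_partialSums (a : ZMod 2) (l : List (ZMod 2)) :
    X ^ l.length ∣ (1 + X) * wordPoly (partialSums a l) - (C a + wordPoly l) := by
  induction l generalizing a with
  | nil => simp
  | cons b l ih =>
    have h := mul_dvd_mul_left X (ih (a + b))
    have h2 : (2 : (ZMod 2)[X]) = 0 := CharTwo.two_eq_zero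
    rw [List.length_cons, pow_succ']
    convert h using 1
    simp only [partialSums, wordPoly, C_add]
    linear_combination X * (C a + C b) * h2

theorem eq_of_X_pow_dvd {l l' : List (ZMod 2)} (hlen : l.length = l'.length)
    (h : X ^ l.length ∣ wordPoly l - wordPoly l') : l = l' := by
  induction l generalizing l' with
  | nil => exact (List.length_eq_zero_iff.1 hlen.symm).symm
  | cons b l ih =>
    cases l' with
    | nil => simp at hlen
    | cons b' l' =>
      have hb : b = b' := by
        have := (dvd_pow_self X (by simp)).trans h
        rw [X_dvd_iff] at this
        simpa [wordPoly, sub_eq_zero] using this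
      subst hb
      rw [ih (by simpa using hlen)]
      rw [List.length_cons, pow_succ'] at h
      refine (mul_dvd_mul_iff_left X_ne_zero).1 (h.trans (dvd_of_eq ?_))
      simp only [wordPoly]
      ring

theorem length_partialSums_iterate (a : ZMod 2) (m : ℕ) (l : List (ZMod 2)) :
    ((partialSums a)^[m] l).length = l.length := by
  induction m with
  | zero => rfl
  | succ m ih => rw [Function.iterate_succ_apply', length_partialSums, ih]

theorem X_pow_dvd_partialSums_iterate (m : ℕ) (l : List (ZMod 2)) :
    X ^ l.length ∣ (1 + X) ^ m * wordPoly ((partialSums 0)^[m] l) - wordPoly l := by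
  induction m with
  | zero => simp
  | succ m ih =>
    have h := X_pow_dvd_partialSums 0 ((partialSums 0)^[m] l)
    rw [length_partialSums_iterate] at h
    rw [Function.iterate_succ_apply']
    convert (h.mul_left ((1 + X) ^ m)).add ih using 1
    simp only [C_0]
    ring

theorem isCoprime_X_pow_of_coeff_zero {p : (ZMod 2)[X]} (hp : p.coeff 0 = 1) (N : ℕ) :
    IsCoprime (X ^ N) p := by
  refine IsCoprime.pow_left ?_
  refine (Polynomial.irreducible_X.coprime_iff_not_dvd).2 ?_
  rw [X_dvd_iff, hp]
  exact one_ne_zero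

theorem partialSums_iterate_eq_self_iff {l : List (ZMod 2)} (hl : l.head? ≠ some 0) (m : ℕ) :
    (partialSums 0)^[m] l = l ↔ X ^ l.length ∣ ((1 + X) ^ m - 1 : (ZMod 2)[X]) := by
  have h := X_pow_dvd_partialSums_iterate m l
  constructor
  · intro hfix
    cases l with
    | nil => simp
    | cons b l =>
      have hb : b = 1 := by
        have hb0 : b ≠ 0 := by simpa using hl
        clear h hfix hl
        decide +revert
      rw [hfix, ← sub_one_mul] at h
      refine (isCoprime_X_pow_of_coeff_zero ?_ _).dvd_of_dvd_mul_right h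
      simp [wordPoly, hb]
  · intro hm
    refine eq_of_X_pow_dvd (length_partialSums_iterate 0 m l) ?_
    rw [length_partialSums_iterate]
    convert h.sub (hm.mul_right (wordPoly ((partialSums 0)^[m] l))) using 1
    ring

theorem partialSums_iterate_two_pow_eq_self_iff {l : List (ZMod 2)} (hl : l.head? ≠ some 0)
    (k : ℕ) : (partialSums 0)^[2 ^ k] l = l ↔ l.length ≤ 2 ^ k := by
  rw [partialSums_iterate_eq_self_iff hl, add_pow_char_pow, one_pow, add_sub_cancel_left]
  exact pow_dvd_pow_iff X_ne_zero Polynomial.not_isUnit_X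

/-- The start word of a composition read from the right, without its last part. -/
def tailWord (c : List ℕ) : List (ZMod 2) := startWord c.reverse.tail

theorem mem_Cset_iff {n : ℕ} {c : List ℕ} :
    c ∈ Cset n ↔ ∃ t : List ℕ, (∀ x ∈ t, 0 < x) ∧ t.sum + 1 = n ∧ c = (1 :: t).reverse := by
  constructor
  · rintro ⟨hpos, hsum, hlast⟩
    rw [← List.head?_reverse, List.head?_eq_some_iff] at hlast
    obtain ⟨t, ht⟩ := hlast
    have hc : c = (1 :: t).reverse := by rw [← ht, List.reverse_reverse]
    subst hc
    refine ⟨t, fun x hx => hpos x (by simp [hx]), ?_, rfl⟩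
    simpa using hsum
  · rintro ⟨t, hpos, hsum, rfl⟩
    refine ⟨?_, by simpa using hsum, by simp⟩
    intro x hx
    simp only [List.mem_reverse, List.mem_cons] at hx
    rcases hx with rfl | hx
    · omega
    · exact hpos x hx

theorem Phi_reverse_cons (x : ℕ) (t : List ℕ) :
    Phi (x :: t).reverse = (x :: phiTail t).reverse := by
  rw [Phi, List.reverse_reverse, phiRev_cons]

theorem Phi_mapsTo (n : ℕ) : Set.MapsTo Phi (Cset n) (Cset n) := by
  intro c hc
  obtain ⟨t, hpos, hsum, rfl⟩ := mem_Cset_iff.1 hc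
  refine mem_Cset_iff.2 ⟨phiTail t, pos_of_mem_phiTail t, ?_, Phi_reverse_cons 1 t⟩
  rw [← length_startWord (pos_of_mem_phiTail t), startWord_phiTail hpos, length_partialSums,
    length_startWord hpos, hsum]

theorem tailWord_Phi {n : ℕ} {c : List ℕ} (hc : c ∈ Cset n) :
    tailWord (Phi c) = partialSums 0 (tailWord c) := by
  obtain ⟨t, hpos, -, rfl⟩ := mem_Cset_iff.1 hc
  simpa [Phi_reverse_cons, tailWord, -List.reverse_cons] using startWord_phiTail hpos

theorem tailWord_injOn (n : ℕ) : Set.InjOn tailWord (Cset n) := by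
  intro c hc d hd h
  obtain ⟨s, hs, -, rfl⟩ := mem_Cset_iff.1 hc
  obtain ⟨t, ht, -, rfl⟩ := mem_Cset_iff.1 hd
  have h' := congrArg (ofStartWord 1) h
  simp only [tailWord, List.reverse_reverse, List.tail_cons, ofStartWord_startWord 1 hs,
    ofStartWord_startWord 1 ht] at h'
  rw [h']

theorem tailWord_Phi_iterate {n : ℕ} {c : List ℕ} (hc : c ∈ Cset n) (m : ℕ) :
    tailWord (Phi^[m] c) = (partialSums 0)^[m] (tailWord c) := by
  induction m with
  | zero => rfl
  | succ m ih =>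
    rw [Function.iterate_succ_apply', Function.iterate_succ_apply',
      tailWord_Phi ((Phi_mapsTo n).iterate m hc), ih]

theorem length_tailWord {n : ℕ} {c : List ℕ} (hc : c ∈ Cset n) :
    (tailWord c).length = n - 1 := by
  obtain ⟨t, hpos, hsum, rfl⟩ := mem_Cset_iff.1 hc
  rw [tailWord, List.reverse_reverse, List.tail_cons, length_startWord hpos]
  omega

theorem head?_tailWord_ne (c : List ℕ) : (tailWord c).head? ≠ some 0 := by
  unfold tailWord
  cases c.reverse.tail <;> simp [startWord]

theorem Phi_iterate_two_pow_eq_self_iff {n : ℕ} {c : List ℕ} (hc : c ∈ Cset n) (k : ℕ) :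
    Phi^[2 ^ k] c = c ↔ n - 1 ≤ 2 ^ k := by
  rw [← (tailWord_injOn n).eq_iff ((Phi_mapsTo n).iterate _ hc) hc, tailWord_Phi_iterate hc,
    partialSums_iterate_two_pow_eq_self_iff (head?_tailWord_ne c), length_tailWord hc]

theorem minimalPeriod_Phi {n : ℕ} {c : List ℕ} (hc : c ∈ Cset n) :
    Function.minimalPeriod Phi c = 2 ^ Nat.clog 2 (n - 1) := by
  have hfix := (Phi_iterate_two_pow_eq_self_iff hc _).2 (Nat.le_pow_clog one_lt_two (n - 1))
  obtain ⟨j, hj, hperiod⟩ := (Nat.dvd_prime_pow Nat.prime_two).1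
    (Function.IsPeriodicPt.minimalPeriod_dvd hfix)
  have hmin := Function.iterate_minimalPeriod (f := Phi) (x := c)
  rw [hperiod, Phi_iterate_two_pow_eq_self_iff hc] at hmin
  rw [hperiod, le_antisymm hj (Nat.clog_le_of_le_pow hmin)]

/-- For every `n ≥ 1`, `Φ` restricts to a bijection of `C_n`
onto itself, and there is a `k ≥ 0` such that for every `c ∈ C_n` the least
positive `m` with `Φ^m(c) = c` equals `2^k`: all `Φ`-orbits on `C_n` have the
same length, a power of `2`. -/
theorem stmt_8 (n : ℕ) (hn : 1 ≤ n) :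
    Set.BijOn Phi (Cset n) (Cset n) ∧
    ∃ k : ℕ, ∀ c ∈ Cset n,
      IsLeast {m : ℕ | 0 < m ∧ Phi^[m] c = c} (2 ^ k) := by
  have hfix : ∀ c ∈ Cset n, Phi^[2 ^ Nat.clog 2 (n - 1)] c = c := fun c hc =>
    (Phi_iterate_two_pow_eq_self_iff hc _).2 (Nat.le_pow_clog one_lt_two (n - 1))
  obtain ⟨r, hr⟩ := Nat.exists_eq_add_one_of_ne_zero
    (pow_pos two_pos (Nat.clog 2 (n - 1))).ne'
  refine ⟨Set.InvOn.bijOn (f' := Phi^[r]) ⟨fun c hc => ?_, fun c hc => ?_⟩ (Phi_mapsTo n)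
    ((Phi_mapsTo n).iterate r), Nat.clog 2 (n - 1), fun c hc => ⟨⟨by positivity, hfix c hc⟩, ?_⟩⟩
  · rw [← Function.iterate_succ_apply, Nat.succ_eq_add_one, ← hr, hfix c hc]
  · rw [← Function.iterate_succ_apply' Phi, Nat.succ_eq_add_one, ← hr, hfix c hc]
  · rintro m ⟨hm, hmc⟩
    rw [← minimalPeriod_Phi hc]
    exact Function.IsPeriodicPt.minimalPeriod_le hm hmc

end Paper
end

section
/- For every n ≥ 0, the number of LCO forests of size n equals the Catalan number C_n; moreover, for every n ≥ 1, the number of LCO forests of size n consisting of a single tree equals C_{n−1}. -/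
namespace Paper

/-- An ordered rooted tree whose every vertex carries a label (a list of
natural numbers, intended to be a composition) and an optional color
(`some true` = top, `some false` = bot, `none` = uncolored). -/
inductive LCOTree : Type where
  | node : List ℕ → Option Bool → List LCOTree → LCOTree

/-- The label is a composition whose last part equals `1`. -/
def LabelOK (c : List ℕ) : Prop := (∀ x ∈ c, 0 < x) ∧ c.getLast? = some 1

/-- Validity of an LCO tree: every vertex has `0` or `≥ 2` children, is labeled
by a composition ending in `1`, carries a color exactly when it has children
and its label has size `≥ 2`, and every leaf that is the rightmost child of its
parent has label of size `≥ 2`. -/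
inductive TreeValid : LCOTree → Prop where
  | mk (lab : List ℕ) (col : Option Bool) (ch : List LCOTree)
      (hlab : LabelOK lab)
      (hdeg : ch.length ≠ 1)
      (hcol : col ≠ none ↔ (ch ≠ [] ∧ 2 ≤ lab.sum))
      (hch : ∀ t ∈ ch, TreeValid t)
      (hlast : ∀ (lab' : List ℕ) (col' : Option Bool) (ch' : List LCOTree),
        ch.getLast? = some (LCOTree.node lab' col' ch') → ch' = [] → 2 ≤ lab'.sum) :
      TreeValid (LCOTree.node lab col ch)

/-- The size of an LCO tree: the sum of the sizes of the labels of its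
vertices. -/
def treeSize : LCOTree → ℕ
  | .node lab _ ch => lab.sum + (ch.attach.map (fun t => treeSize t.1)).sum
decreasing_by
  have := List.sizeOf_lt_of_mem t.2
  cases t with | mk a ha => simp_all; omega

/-- An LCO forest is a list of valid LCO trees; its size is the sum of the
sizes of its trees. -/
def ForestValid (f : List LCOTree) : Prop := ∀ t ∈ f, TreeValid t

def forestSize (f : List LCOTree) : ℕ := (f.map treeSize).sum

/-- The fibers of the size function `s` on `S` are finite. -/
def FiniteFibers {α : Type*} (s : α → ℕ) (S : Set α) : Prop :=
  ∀ n, {a | a ∈ S ∧ s a = n}.Finite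

/-- The generating function of the set `S` with respect to the size function `s`. -/
noncomputable def genFun {α : Type*} (s : α → ℕ) (S : Set α) : PowerSeries ℤ :=
  PowerSeries.mk fun n => ({a | a ∈ S ∧ s a = n}.ncard : ℤ)

lemma FiniteFibers.mono {α : Type*} {s : α → ℕ} {S T : Set α} (hT : FiniteFibers s T)
    (h : S ⊆ T) : FiniteFibers s S :=
  fun n => (hT n).subset fun _ ha => ⟨h ha.1, ha.2⟩

lemma genFun_union {α : Type*} {s : α → ℕ} {S T : Set α} (hS : FiniteFibers s S)
    (hT : FiniteFibers s T) (hd : Disjoint S T) :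
    genFun s (S ∪ T) = genFun s S + genFun s T := by
  ext n
  simp only [genFun, PowerSeries.coeff_mk, map_add]
  rw [← Nat.cast_add, ← Set.ncard_union_eq _ (hS n) (hT n)]
  · congr 2
    ext a
    simp only [Set.mem_ofPred_eq, Set.mem_union]
    tauto
  · exact hd.mono (fun _ h => h.1) (fun _ h => h.1)

lemma genFun_image {α β : Type*} {s : α → ℕ} {s' : β → ℕ} {f : α → β} (S : Set α)
    (hf : Function.Injective f) (hs : ∀ a, s' (f a) = s a) :
    genFun s' (f '' S) = genFun s S := by
  ext n
  simp only [genFun, PowerSeries.coeff_mk]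
  rw [← Set.ncard_image_of_injective _ hf]
  congr 2
  ext b
  simp only [Set.mem_ofPred_eq, Set.mem_image]
  constructor
  · rintro ⟨⟨a, ha, rfl⟩, hn⟩
    exact ⟨a, ⟨ha, (hs a).symm.trans hn⟩, rfl⟩
  · rintro ⟨a, ⟨ha, hn⟩, rfl⟩
    exact ⟨⟨a, ha, rfl⟩, (hs a).trans hn⟩

lemma genFun_prod {α β : Type*} {s : α → ℕ} {s' : β → ℕ} {S : Set α} {T : Set β}
    (hS : FiniteFibers s S) (hT : FiniteFibers s' T) :
    genFun (fun p : α × β => s p.1 + s' p.2) (S ×ˢ T) = genFun s S * genFun s' T := by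
  classical
  ext n
  simp only [genFun, PowerSeries.coeff_mk, PowerSeries.coeff_mul]
  have key : {p : α × β | p ∈ S ×ˢ T ∧ s p.1 + s' p.2 = n} =
      (((Finset.HasAntidiagonal.antidiagonal n).biUnion fun ij =>
        (hS ij.1).toFinset ×ˢ (hT ij.2).toFinset : Finset (α × β)) : Set (α × β)) := by
    ext ⟨a, b⟩
    simp only [Set.mem_ofPred_eq, Set.mem_prod, Finset.coe_biUnion, Set.mem_iUnion,
      Finset.mem_coe, Finset.mem_product, Set.Finite.mem_toFinset,
      Finset.HasAntidiagonal.mem_antidiagonal]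
    constructor
    · rintro ⟨⟨ha, hb⟩, hn⟩
      exact ⟨(s a, s' b), hn, ⟨ha, rfl⟩, hb, rfl⟩
    · rintro ⟨⟨i, j⟩, hn, ⟨ha, rfl⟩, hb, rfl⟩
      exact ⟨⟨ha, hb⟩, hn⟩
  rw [key, Set.ncard_coe_finset, Finset.card_biUnion]
  · push_cast
    refine Finset.sum_congr rfl fun ij _ => ?_
    rw [Finset.card_product, Set.ncard_eq_toFinset_card _ (hS ij.1),
      Set.ncard_eq_toFinset_card _ (hT ij.2)]
    push_cast
    rfl
  · intro x _ y _ hxy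
    refine Finset.disjoint_left.2 ?_
    rintro ⟨a, b⟩ h1 h2
    simp only [Finset.mem_product, Set.Finite.mem_toFinset, Set.mem_ofPred_eq] at h1 h2
    exact hxy (Prod.ext (h1.1.2.symm.trans h2.1.2) (h1.2.2.symm.trans h2.2.2))

lemma genFun_image2 {α β γ : Type*} {s : α → ℕ} {s' : β → ℕ} {s'' : γ → ℕ} {f : α → β → γ}
    {S : Set α} {T : Set β} (hS : FiniteFibers s S) (hT : FiniteFibers s' T)
    (hf : Function.Injective2 f) (hs : ∀ a b, s'' (f a b) = s a + s' b) :
    genFun s'' (Set.image2 f S T) = genFun s S * genFun s' T := by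
  rw [← genFun_prod hS hT, ← Set.image_uncurry_prod]
  exact genFun_image _ hf.uncurry fun p => hs p.1 p.2

lemma genFun_singleton {α : Type*} (s : α → ℕ) (a : α) :
    genFun s {a} = PowerSeries.X ^ s a := by
  ext n
  simp only [genFun, PowerSeries.coeff_mk, PowerSeries.coeff_X_pow, Set.mem_singleton_iff]
  split_ifs with h
  · have : {b | b = a ∧ s b = n} = {a} := by
      ext b
      simp only [Set.mem_ofPred_eq, Set.mem_singleton_iff, and_iff_left_iff_imp]
      rintro rfl
      exact h.symm
    simp [this]
  · have : {b | b = a ∧ s b = n} = ∅ := by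
      ext b
      simp only [Set.mem_ofPred_eq, Set.mem_empty_iff_false, iff_false, not_and]
      rintro rfl h'
      exact h h'.symm
    simp [this]

lemma finiteFibers_singleton {α : Type*} (s : α → ℕ) (a : α) : FiniteFibers s {a} :=
  fun _ => (Set.finite_singleton a).subset fun _ h => h.1

lemma finiteFibers_id (S : Set ℕ) : FiniteFibers id S :=
  fun n => (Set.finite_singleton n).subset fun _ h => h.2

lemma genFun_pos : (1 - PowerSeries.X) * genFun id {n : ℕ | 0 < n} = PowerSeries.X := by
  have : genFun id {n : ℕ | 0 < n} = PowerSeries.X * PowerSeries.mk 1 := by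
    ext n
    cases n with
    | zero =>
      have : {a : ℕ | 0 < a ∧ a = 0} = ∅ :=
        Set.eq_empty_of_forall_notMem fun _ h => h.1.ne' h.2
      simp [genFun, this]
    | succ n =>
      rw [PowerSeries.coeff_succ_X_mul]
      have : {a : ℕ | 0 < a ∧ a = n + 1} = {n + 1} := by
        ext a
        simp only [Set.mem_ofPred_eq, Set.mem_singleton_iff]
        omega
      simp [genFun, this]
  rw [this, mul_left_comm, mul_comm (1 - _), PowerSeries.mk_one_mul_one_sub_eq_one, mul_one]

lemma finiteFibers_pos_lists : FiniteFibers List.sum {c : List ℕ | ∀ x ∈ c, 0 < x} := by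
  intro n
  refine (Set.finite_range fun c : Composition n => c.blocks).subset ?_
  rintro c ⟨hc, hn⟩
  exact ⟨⟨c, fun {i} hi => hc i hi, hn⟩, rfl⟩

/-- The set of valid labels. -/
def labels : Set (List ℕ) := {c | LabelOK c}

lemma finiteFibers_labels : FiniteFibers List.sum labels :=
  finiteFibers_pos_lists.mono fun _ h => h.1

lemma LabelOK.sum_pos {c : List ℕ} (h : LabelOK c) : 0 < c.sum := by
  have : 1 ∈ c := List.mem_of_getLast? h.2
  have := List.single_le_sum (l := c) (fun _ _ => Nat.zero_le _) 1 this
  omega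

lemma labelOK_one : LabelOK [1] := by simp [LabelOK]

lemma labelOK_cons {x : ℕ} {c : List ℕ} (hc : c ≠ []) :
    LabelOK (x :: c) ↔ 0 < x ∧ LabelOK c := by
  obtain ⟨y, c, rfl⟩ := List.exists_cons_of_ne_nil hc
  simp only [LabelOK, List.forall_mem_cons, List.getLast?_cons_cons]
  tauto

lemma LabelOK.ne_nil {c : List ℕ} (h : LabelOK c) : c ≠ [] := by
  rintro rfl
  simp [LabelOK] at h

lemma LabelOK.eq_one {c : List ℕ} (h : LabelOK c) (hs : ¬ 2 ≤ c.sum) : c = [1] := by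
  match c, h, hs with
  | [], h, _ => exact absurd rfl h.ne_nil
  | [x], h, _ => simpa [LabelOK] using h.2
  | x :: y :: c, h, hs =>
    obtain ⟨hx, hc⟩ := (labelOK_cons (by simp)).1 h
    have := hc.sum_pos
    rw [List.sum_cons] at hs
    omega

lemma labels_eq :
    labels = {[1]} ∪ Set.image2 List.cons {n : ℕ | 0 < n} labels := by
  ext c
  simp only [labels, Set.mem_ofPred_eq, Set.mem_union, Set.mem_singleton_iff, Set.mem_image2]
  constructor
  · intro h
    match c, h with
    | [], h => exact absurd rfl h.ne_nil
    | [x], h => left; simpa [LabelOK] using h.2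
    | x :: y :: c, h =>
      obtain ⟨hx, hc⟩ := (labelOK_cons (by simp)).1 h
      exact Or.inr ⟨x, hx, _, hc, rfl⟩
  · rintro (rfl | ⟨x, hx, c, hc, rfl⟩)
    · exact labelOK_one
    · exact (labelOK_cons hc.ne_nil).2 ⟨hx, hc⟩

lemma cons_injective2 {α : Type*} : Function.Injective2 (List.cons : α → List α → List α) :=
  fun _ _ _ _ h => List.cons.inj h

lemma genFun_labels : genFun List.sum labels =
    PowerSeries.X + genFun id {n : ℕ | 0 < n} * genFun List.sum labels := by
  conv_lhs => rw [labels_eq]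
  rw [genFun_union (finiteFibers_singleton _ _), genFun_singleton,
    genFun_image2 (s := id) (finiteFibers_id _) finiteFibers_labels cons_injective2]
  · simp
  · simp
  · refine finiteFibers_labels.mono ?_
    conv_rhs => rw [labels_eq]
    exact Set.subset_union_right
  · rw [Set.disjoint_left]
    rintro _ rfl ⟨x, _, c, hc, h⟩
    simp only [List.cons.injEq] at h
    exact LabelOK.ne_nil hc h.2

/-- The set of valid labels of size at least two. -/
def bigLabels : Set (List ℕ) := {c | LabelOK c ∧ 2 ≤ c.sum}

lemma finiteFibers_bigLabels : FiniteFibers List.sum bigLabels :=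
  finiteFibers_labels.mono fun _ h => h.1

lemma genFun_labels_eq_add : genFun List.sum labels =
    PowerSeries.X + genFun List.sum bigLabels := by
  have : labels = {[1]} ∪ bigLabels := by
    ext c
    simp only [labels, bigLabels, Set.mem_ofPred_eq, Set.mem_union, Set.mem_singleton_iff]
    constructor
    · intro h
      by_cases hs : 2 ≤ c.sum
      · exact Or.inr ⟨h, hs⟩
      · exact Or.inl (h.eq_one hs)
    · rintro (rfl | h)
      · exact labelOK_one
      · exact h.1
  rw [this, genFun_union (finiteFibers_singleton _ _) finiteFibers_bigLabels, genFun_singleton]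
  · simp
  · rw [Set.disjoint_left]
    rintro _ rfl h
    simp [bigLabels] at h

lemma treeSize_node (lab : List ℕ) (col : Option Bool) (ch : List LCOTree) :
    treeSize (.node lab col ch) = lab.sum + forestSize ch := by
  rw [treeSize, forestSize, List.attach_map_val]

lemma forestSize_cons (t : LCOTree) (f : List LCOTree) :
    forestSize (t :: f) = treeSize t + forestSize f := by
  simp [forestSize]

lemma forestValid_cons {t : LCOTree} {f : List LCOTree} :
    ForestValid (t :: f) ↔ TreeValid t ∧ ForestValid f := by
  simp [ForestValid]

lemma finiteFibers_forests : FiniteFibers forestSize {f | ForestValid f} := by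
  intro n
  induction n using Nat.strong_induction_on with
  | _ n ih =>
    have hF : (⋃ m ∈ Set.Iio n, {f | f ∈ {f | ForestValid f} ∧ forestSize f = m}).Finite :=
      (Set.finite_Iio n).biUnion ih
    have hL : (⋃ m ∈ Set.Iic n, {c | c ∈ labels ∧ c.sum = m}).Finite :=
      (Set.finite_Iic n).biUnion fun m _ => finiteFibers_labels m
    refine ((Set.finite_singleton ([] : List LCOTree)).union
      (((hL.prod (Set.finite_univ (α := Option Bool))).prod (hF.prod hF)).image
        fun p => LCOTree.node p.1.1 p.1.2 p.2.1 :: p.2.2)).subset ?_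
    rintro f ⟨hf, hn⟩
    match f, hf, hn with
    | [], _, _ => exact Or.inl rfl
    | .node lab col ch :: f, hf, hn =>
      obtain ⟨ht, hf⟩ := forestValid_cons.1 hf
      cases ht with
      | mk _ _ _ hlab _ _ hch _ =>
        rw [forestSize_cons, treeSize_node] at hn
        have := hlab.sum_pos
        refine Or.inr ⟨((lab, col), ch, f), ⟨⟨?_, Set.mem_univ _⟩, ?_, ?_⟩, rfl⟩
        · exact Set.mem_biUnion (x := lab.sum) (Set.mem_Iic.2 (by omega)) ⟨hlab, rfl⟩
        · exact Set.mem_biUnion (x := forestSize ch) (Set.mem_Iio.2 (by omega)) ⟨hch, rfl⟩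
        · exact Set.mem_biUnion (x := forestSize f) (Set.mem_Iio.2 (by omega)) ⟨hf, rfl⟩

lemma finiteFibers_trees : FiniteFibers treeSize {t | TreeValid t} := by
  intro n
  refine Set.Finite.of_finite_image (f := fun t => [t]) ((finiteFibers_forests n).subset ?_)
    fun _ _ _ _ h => List.singleton_inj.1 h
  rintro _ ⟨t, ⟨ht, hn⟩, rfl⟩
  exact ⟨by simpa [ForestValid] using ht, by simpa [forestSize] using hn⟩

lemma genFun_forests : genFun forestSize {f | ForestValid f} =
    1 + genFun treeSize {t | TreeValid t} * genFun forestSize {f | ForestValid f} := by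
  have h : {f | ForestValid f} =
      {[]} ∪ Set.image2 List.cons {t | TreeValid t} {f | ForestValid f} := by
    ext f
    simp only [Set.mem_ofPred_eq, Set.mem_union, Set.mem_singleton_iff, Set.mem_image2]
    cases f with
    | nil => simp [ForestValid]
    | cons t f => simp [forestValid_cons]
  conv_lhs => rw [h]
  rw [genFun_union (finiteFibers_singleton _ _), genFun_singleton,
    genFun_image2 finiteFibers_trees finiteFibers_forests cons_injective2 forestSize_cons]
  · simp [forestSize]
  · refine finiteFibers_forests.mono ?_
    conv_rhs => rw [h]
    exact Set.subset_union_right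
  · rw [Set.disjoint_left]
    rintro _ rfl ⟨x, _, c, hc, h⟩
    cases h

/-- The single-vertex tree of size one. -/
def unitLeaf : LCOTree := .node [1] none []

lemma treeValid_unitLeaf : TreeValid unitLeaf :=
  .mk _ _ _ labelOK_one (by simp) (by simp) (by simp) (by simp)

/-- Valid trees other than the single-vertex tree of size one. -/
def properTrees : Set LCOTree := {t | TreeValid t ∧ t ≠ unitLeaf}

/-- Nonempty valid forests whose last tree is not the single-vertex tree of size one. -/
def properForests : Set (List LCOTree) :=
  {f | ForestValid f ∧ ∃ t, f.getLast? = some t ∧ t ≠ unitLeaf}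

lemma finiteFibers_properForests : FiniteFibers forestSize properForests :=
  finiteFibers_forests.mono fun _ h => h.1

lemma finiteFibers_properTrees : FiniteFibers treeSize properTrees :=
  finiteFibers_trees.mono fun _ h => h.1

lemma genFun_trees_eq_add : genFun treeSize {t | TreeValid t} =
    PowerSeries.X + genFun treeSize properTrees := by
  have : {t | TreeValid t} = {unitLeaf} ∪ properTrees := by
    ext t
    simp only [properTrees, Set.mem_ofPred_eq, Set.mem_union, Set.mem_singleton_iff]
    by_cases h : t = unitLeaf
    · simp [h, treeValid_unitLeaf]
    · simp [h]
  rw [this, genFun_union (finiteFibers_singleton _ _) finiteFibers_properTrees, genFun_singleton]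
  · simp [unitLeaf, treeSize_node, forestSize]
  · rw [Set.disjoint_left]
    rintro _ rfl h
    exact h.2 rfl

/-- Valid forests of at least two trees whose last tree is not the single-vertex tree of
size one. -/
def properChildren : Set (List LCOTree) :=
  Set.image2 List.cons {t | TreeValid t} properForests

lemma genFun_properChildren : genFun forestSize properChildren =
    genFun treeSize {t | TreeValid t} * genFun forestSize properForests :=
  genFun_image2 finiteFibers_trees finiteFibers_properForests cons_injective2 forestSize_cons

lemma mem_properForests_cons {t : LCOTree} {f : List LCOTree} (hf : f ≠ []) :
    t :: f ∈ properForests ↔ TreeValid t ∧ f ∈ properForests := by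
  obtain ⟨u, f, rfl⟩ := List.exists_cons_of_ne_nil hf
  simp only [properForests, Set.mem_ofPred_eq, forestValid_cons, List.getLast?_cons_cons]
  tauto

lemma ne_nil_of_mem_properForests {f : List LCOTree} (hf : f ∈ properForests) : f ≠ [] := by
  rintro rfl
  simp [properForests] at hf

lemma properChildren_subset : properChildren ⊆ properForests := by
  rintro _ ⟨t, ht, f, hf, rfl⟩
  exact (mem_properForests_cons (ne_nil_of_mem_properForests hf)).2 ⟨ht, hf⟩

lemma finiteFibers_properChildren : FiniteFibers forestSize properChildren :=
  finiteFibers_properForests.mono properChildren_subset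

lemma mem_properChildren {f : List LCOTree} :
    f ∈ properChildren ↔ f ∈ properForests ∧ f.length ≠ 1 := by
  constructor
  · intro h
    refine ⟨properChildren_subset h, ?_⟩
    obtain ⟨t, _, f, hf, rfl⟩ := h
    simpa using ne_nil_of_mem_properForests hf
  · rintro ⟨h, hl⟩
    match f, h, hl with
    | [], h, _ => exact absurd rfl (ne_nil_of_mem_properForests h)
    | [_], _, hl => exact absurd rfl hl
    | t :: u :: f, h, _ =>
      obtain ⟨ht, hf⟩ := (mem_properForests_cons (by simp)).1 h
      exact ⟨t, ht, _, hf, rfl⟩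

lemma genFun_properForests : genFun forestSize properForests =
    genFun treeSize properTrees + genFun forestSize properChildren := by
  have h : properForests = (fun t => [t]) '' properTrees ∪ properChildren := by
    ext f
    rw [Set.mem_union, mem_properChildren, Set.mem_image]
    match f with
    | [] => simp
    | [t] => simp [properForests, properTrees, ForestValid]
    | t :: u :: f => simp
  have h1 : (fun t => [t]) '' properTrees ⊆ properForests := by
    rw [h]
    exact Set.subset_union_left
  conv_lhs => rw [h]
  rw [genFun_union (finiteFibers_properForests.mono h1) finiteFibers_properChildren,
    genFun_image (s := treeSize) _ List.singleton_injective]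
  · simp [forestSize]
  · rw [Set.disjoint_left]
    rintro _ ⟨t, _, rfl⟩ h
    exact (mem_properChildren.1 h).2 rfl

lemma treeValid_leaf_iff {lab : List ℕ} {col : Option Bool} :
    TreeValid (.node lab col []) ↔ LabelOK lab ∧ col = none := by
  constructor
  · rintro ⟨_, _, _, hlab, _, hcol, _, _⟩
    exact ⟨hlab, by simpa using hcol⟩
  · rintro ⟨hlab, rfl⟩
    exact .mk _ _ _ hlab (by simp) (by simp) (by simp) (by simp)

lemma eq_unitLeaf_iff {lab : List ℕ} {col : Option Bool} {ch : List LCOTree}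
    (h : TreeValid (.node lab col ch)) :
    LCOTree.node lab col ch = unitLeaf ↔ ch = [] ∧ ¬ 2 ≤ lab.sum := by
  constructor
  · intro h
    simp only [unitLeaf, LCOTree.node.injEq] at h
    obtain ⟨rfl, rfl, rfl⟩ := h
    simp
  · rintro ⟨rfl, hs⟩
    obtain ⟨hlab, rfl⟩ := treeValid_leaf_iff.1 h
    rw [hlab.eq_one hs, unitLeaf]

lemma treeValid_node_iff {lab : List ℕ} {col : Option Bool} {ch : List LCOTree} (hch : ch ≠ []) :
    TreeValid (.node lab col ch) ↔
      LabelOK lab ∧ (col ≠ none ↔ 2 ≤ lab.sum) ∧ ch ∈ properChildren := by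
  rw [mem_properChildren]
  constructor
  · rintro ⟨_, _, _, hlab, hdeg, hcol, hv, hlast⟩
    refine ⟨hlab, by simpa [hch] using hcol, ⟨hv, ?_⟩, hdeg⟩
    have hl := List.getLast?_eq_some_getLast hch
    refine ⟨_, hl, ?_⟩
    have hvl := hv _ (List.getLast_mem hch)
    generalize ch.getLast hch = t at hl hvl
    obtain ⟨lab', col', ch'⟩ := t
    rw [Ne, eq_unitLeaf_iff hvl]
    rintro ⟨h1, h2⟩
    exact h2 (hlast _ _ _ hl h1)
  · rintro ⟨hlab, hcol, ⟨hv, t, hl, ht⟩, hdeg⟩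
    refine .mk _ _ _ hlab hdeg (by simpa [hch] using hcol) hv ?_
    intro lab' col' ch' hl' hc
    by_contra hs
    have hvl := hv _ (List.mem_of_getLast? hl')
    rw [hl, Option.some_inj] at hl'
    subst hl'
    exact ht ((eq_unitLeaf_iff hvl).2 ⟨hc, hs⟩)

/-- Trees with root color `col`, root label in `L` and list of children in `K`. -/
def nodes (col : Option Bool) (L : Set (List ℕ)) (K : Set (List LCOTree)) : Set LCOTree :=
  Set.image2 (fun lab ch => .node lab col ch) L K

lemma mem_nodes {lab : List ℕ} {col col' : Option Bool} {ch : List LCOTree}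
    {L : Set (List ℕ)} {K : Set (List LCOTree)} :
    .node lab col ch ∈ nodes col' L K ↔ lab ∈ L ∧ col = col' ∧ ch ∈ K := by
  simp only [nodes, Set.mem_image2, LCOTree.node.injEq]
  constructor
  · rintro ⟨_, h1, _, h2, rfl, rfl, rfl⟩
    exact ⟨h1, rfl, h2⟩
  · rintro ⟨h1, rfl, h2⟩
    exact ⟨_, h1, _, h2, rfl, rfl, rfl⟩

lemma genFun_nodes (col : Option Bool) {L : Set (List ℕ)} {K : Set (List LCOTree)}
    (hL : FiniteFibers List.sum L) (hK : FiniteFibers forestSize K) :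
    genFun treeSize (nodes col L K) = genFun List.sum L * genFun forestSize K := by
  refine genFun_image2 hL hK ?_ fun lab ch => treeSize_node lab col ch
  intro _ _ _ _ h
  simp only [LCOTree.node.injEq] at h
  exact ⟨h.1, h.2.2⟩

lemma trees_eq : {t | TreeValid t} =
    nodes none labels {[]} ∪ (nodes none {[1]} properChildren ∪
      (nodes (some true) bigLabels properChildren ∪
        nodes (some false) bigLabels properChildren)) := by
  ext ⟨lab, col, ch⟩
  simp only [Set.mem_union, mem_nodes, Set.mem_ofPred_eq, Set.mem_singleton_iff]
  by_cases hch : ch = []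
  · subst hch
    have : [] ∉ properChildren := fun h =>
      ne_nil_of_mem_properForests (properChildren_subset h) rfl
    simp [treeValid_leaf_iff, this, labels]
  · have h1 : lab = [1] ↔ LabelOK lab ∧ ¬ 2 ≤ lab.sum :=
      ⟨by rintro rfl; exact ⟨labelOK_one, by simp⟩, fun h => h.1.eq_one h.2⟩
    rw [treeValid_node_iff hch, h1]
    simp only [hch, bigLabels, Set.mem_ofPred_eq]
    rcases col with _ | _ | _ <;> simp <;> tauto

lemma genFun_trees : genFun treeSize {t | TreeValid t} =
    genFun List.sum labels +
      (PowerSeries.X + 2 * genFun List.sum bigLabels) * genFun forestSize properChildren := by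
  have hsub := trees_eq.symm.subset
  simp only [Set.union_subset_iff] at hsub
  obtain ⟨h1, h2, h3, h4⟩ := hsub
  have f1 := finiteFibers_trees.mono h1
  have f2 := finiteFibers_trees.mono h2
  have f3 := finiteFibers_trees.mono h3
  have f4 := finiteFibers_trees.mono h4
  have hK : [] ∉ properChildren := fun h =>
    ne_nil_of_mem_properForests (properChildren_subset h) rfl
  rw [trees_eq, genFun_union f1, genFun_union f2, genFun_union f3 f4,
    genFun_nodes _ finiteFibers_labels (finiteFibers_singleton _ _),
    genFun_nodes _ (finiteFibers_singleton _ _) finiteFibers_properChildren,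
    genFun_nodes _ finiteFibers_bigLabels finiteFibers_properChildren,
    genFun_nodes _ finiteFibers_bigLabels finiteFibers_properChildren,
    genFun_singleton, genFun_singleton]
  · simp only [forestSize, List.map_nil, List.sum_nil, List.sum_singleton, pow_zero, pow_one]
    ring
  · rw [Set.disjoint_left]
    rintro ⟨_, _, _⟩ h h'
    rw [mem_nodes] at h h'
    simp_all
  · exact finiteFibers_trees.mono (Set.union_subset h3 h4)
  · rw [Set.disjoint_left]
    rintro ⟨_, _, _⟩ h h'
    simp only [Set.mem_union, mem_nodes] at h h'
    simp_all
  · exact finiteFibers_trees.mono (Set.union_subset h2 (Set.union_subset h3 h4))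
  · rw [Set.disjoint_left]
    rintro ⟨_, _, _⟩ h h'
    simp only [Set.mem_union, mem_nodes, Set.mem_singleton_iff] at h h'
    obtain ⟨-, -, rfl⟩ := h
    simp_all

lemma one_sub_X_ne_zero : (1 - PowerSeries.X : PowerSeries ℤ) ≠ 0 := fun h => by
  simpa using congrArg PowerSeries.constantCoeff h

/-- The generating function `T` of LCO trees satisfies `T = X + T ^ 2`. -/
lemma genFun_trees_eq : genFun treeSize {t | TreeValid t} =
    PowerSeries.X + genFun treeSize {t | TreeValid t} ^ 2 := by
  have hN := genFun_pos
  have hL := genFun_labels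
  have hB := genFun_labels_eq_add
  have hT := genFun_trees_eq_add
  have hC := genFun_properChildren
  have hG := genFun_properForests
  have hR := genFun_trees
  generalize genFun treeSize {t | TreeValid t} = T at *
  generalize genFun id {n : ℕ | 0 < n} = N at *
  generalize genFun List.sum labels = L at *
  generalize genFun List.sum bigLabels = B at *
  generalize genFun treeSize properTrees = T' at *
  generalize genFun forestSize properChildren = K at *
  generalize genFun forestSize properForests = G at *
  set x : PowerSeries ℤ := PowerSeries.X
  have hL' : (1 - 2 * x) * L = x * (1 - x) := by linear_combination (1 - x) * hL + L * hN
  have hR' : T = L + (2 * L - x) * (T * G) := by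
    linear_combination hR + (x + 2 * B) * hC - 2 * T * G * hB
  have hG' : G * (1 - T) = T - x := by linear_combination hG + hC - hT
  have key : (1 - x) * (T - (x + T ^ 2)) = 0 := by
    linear_combination (1 - 2 * x) * (1 - T) * hR' + (1 - 2 * x) * (2 * L - x) * T * hG' +
      (1 - T + 2 * T * (T - x)) * hL'
  exact sub_eq_zero.1 ((mul_eq_zero.1 key).resolve_left one_sub_X_ne_zero)

/-- The generating function of the Catalan numbers, with integer coefficients. -/
noncomputable def catalanGenFun : PowerSeries ℤ :=
  PowerSeries.catalanSeries.map (Nat.castRingHom ℤ)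

lemma coeff_catalanGenFun (n : ℕ) : PowerSeries.coeff n catalanGenFun = (catalan n : ℤ) := by
  simp [catalanGenFun]

lemma catalanGenFun_eq : catalanGenFun = 1 + PowerSeries.X * catalanGenFun ^ 2 := by
  have h := congrArg (PowerSeries.map (Nat.castRingHom ℤ))
    PowerSeries.catalanSeries_sq_mul_X_add_one
  rw [map_add, map_mul, map_pow, PowerSeries.map_X, map_one] at h
  rw [catalanGenFun]
  linear_combination -h

lemma TreeValid.treeSize_pos {t : LCOTree} (h : TreeValid t) : 0 < treeSize t := by
  obtain ⟨lab, col, ch, hlab, _, _, _, _⟩ := h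
  rw [treeSize_node]
  exact Nat.add_pos_left hlab.sum_pos _

lemma genFun_trees_eq_catalan : genFun treeSize {t | TreeValid t} =
    PowerSeries.X * catalanGenFun := by
  have hT := genFun_trees_eq
  have hC := catalanGenFun_eq
  have h0 : PowerSeries.constantCoeff (genFun treeSize {t | TreeValid t}) = 0 := by
    have : {t | t ∈ {t | TreeValid t} ∧ treeSize t = 0} = ∅ :=
      Set.eq_empty_of_forall_notMem fun t h => h.1.treeSize_pos.ne' h.2
    rw [← PowerSeries.coeff_zero_eq_constantCoeff_apply, genFun, PowerSeries.coeff_mk, this,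
      Set.ncard_empty, Nat.cast_zero]
  generalize genFun treeSize {t | TreeValid t} = T at *
  have key : (T - PowerSeries.X * catalanGenFun) * (1 - T - PowerSeries.X * catalanGenFun) = 0 := by
    linear_combination hT - PowerSeries.X * hC
  rcases mul_eq_zero.1 key with h | h
  · exact sub_eq_zero.1 h
  · simpa [h0] using congrArg PowerSeries.constantCoeff h

lemma genFun_forests_eq_catalan : genFun forestSize {f | ForestValid f} = catalanGenFun := by
  have hF := genFun_forests
  have hC := catalanGenFun_eq
  rw [genFun_trees_eq_catalan] at hF
  linear_combination catalanGenFun * hF - genFun forestSize {f | ForestValid f} * hC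

/-- For every `n ≥ 0` the number of LCO forests of size `n`
is the Catalan number `C_n`, and for every `n ≥ 1` the number of one-tree LCO
forests of size `n` is `C_{n-1}`. -/
theorem stmt_13 :
    (∀ n : ℕ,
      Nat.card {f : List LCOTree // ForestValid f ∧ forestSize f = n} = catalan n) ∧
    (∀ n : ℕ, 1 ≤ n →
      Nat.card {t : LCOTree // TreeValid t ∧ treeSize t = n} = catalan (n - 1)) := by
  constructor
  · intro n
    have h := congrArg (PowerSeries.coeff n) genFun_forests_eq_catalan
    rw [genFun, PowerSeries.coeff_mk, coeff_catalanGenFun, Nat.cast_inj] at h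
    exact h
  · intro n hn
    obtain ⟨n, rfl⟩ := Nat.exists_eq_add_of_le' hn
    have h := congrArg (PowerSeries.coeff (n + 1)) genFun_trees_eq_catalan
    rw [PowerSeries.coeff_succ_X_mul] at h
    rw [genFun, PowerSeries.coeff_mk, coeff_catalanGenFun, Nat.cast_inj] at h
    exact h

end Paper
end

section
/- For every n ≥ 0, the number of right-planted binary trees with n + 1 edges and no erasable vertex equals the Motzkin number M_n. -/
namespace Paper

/-- The Motzkin numbers: `M 0 = 1` and
`M (n+1) = M n + ∑_{k=0}^{n-1} M k * M (n-1-k)`. -/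
def motzkin : ℕ → ℕ
  | 0 => 1
  | n + 1 =>
    motzkin n +
      ((List.range n).attach.map
        (fun k => motzkin k.1 * motzkin (n - 1 - k.1))).sum
decreasing_by
  · exact Nat.lt_succ_self n
  · have := List.mem_range.mp k.2; omega
  · have := List.mem_range.mp k.2; omega


/-- A binary tree: empty, or a root with an ordered pair of binary subtrees. -/
inductive BTree : Type where
  | nil : BTree
  | node : BTree → BTree → BTree

/-- Number of vertices of a binary tree. -/
def nVertices : BTree → ℕ
  | .nil => 0
  | .node l r => nVertices l + nVertices r + 1

/-- Number of edges of a binary tree (number of vertices minus one). -/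
def nEdges (t : BTree) : ℕ := nVertices t - 1

/-- A nonempty binary tree is right-planted if its root has empty left subtree
and nonempty right subtree. -/
def RightPlanted : BTree → Prop
  | .nil => False
  | .node l r => l = .nil ∧ r ≠ .nil

/-- `hasErasAux isLeft t`: the subtree `t`, attached to its parent as a left
child (`isLeft = true`) or a right child (`isLeft = false`), contains an
erasable vertex.  A vertex is erasable if it has a parent, exactly one of its
two subtrees is nonempty, and it is a left child whose unique child is a left
child, or a right child whose unique child is a right child. -/
def hasErasAux : Bool → BTree → Prop
  | _, .nil => False
  | isLeft, .node l r =>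
      ((l ≠ .nil ∧ r = .nil ∧ isLeft = true) ∨
        (l = .nil ∧ r ≠ .nil ∧ isLeft = false)) ∨
      hasErasAux true l ∨ hasErasAux false r

/-- The binary tree `t` has an erasable vertex (the root, having no parent, is
never erasable). -/
def HasErasable : BTree → Prop
  | .nil => False
  | .node l r => hasErasAux true l ∨ hasErasAux false r

/-- The tree whose root has `t` as its only nonempty subtree, on the right if `b` and on the left
otherwise. -/
def graft : Bool → BTree → BTree
  | true, t => .node .nil t
  | false, t => .node t .nil

theorem graft_injective (b : Bool) : Function.Injective (graft b) := by
  intro s t h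
  cases b <;> simpa [graft] using h

theorem nVertices_eq_zero {t : BTree} : nVertices t = 0 ↔ t = .nil := by
  cases t <;> simp [nVertices]

theorem motzkin_succ (n : ℕ) :
    motzkin (n + 1) =
      motzkin n + ∑ k ∈ Finset.range n, motzkin k * motzkin (n - 1 - k) := by
  rw [motzkin, List.attach_map_val (f := fun k => motzkin k * motzkin (n - 1 - k))]
  rfl

/-- A tree with at least two vertices, attached to a parent on the side `b`, has no erasable vertex
exactly when its root either has two nonempty subtrees, or its only child is on the side other
than `b`, and no subtree of the root has an erasable vertex. -/
theorem mem_reduced_succ_iff (b : Bool) (n : ℕ) (t : BTree) :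
    (nVertices t = n + 2 ∧ ¬ hasErasAux b t) ↔
      (∃ u, (nVertices u = n + 1 ∧ ¬ hasErasAux (!b) u) ∧ graft b u = t) ∨
      ∃ k < n, ∃ l r, (nVertices l = k + 1 ∧ ¬ hasErasAux true l) ∧
        (nVertices r = n - 1 - k + 1 ∧ ¬ hasErasAux false r) ∧ BTree.node l r = t := by
  constructor
  · rintro ⟨hv, he⟩
    cases t with
    | nil => simp [nVertices] at hv
    | node l r =>
      simp only [nVertices] at hv
      simp only [hasErasAux, not_or] at he
      obtain ⟨⟨hl, hr⟩, hel, her⟩ := he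
      by_cases l0 : l = .nil
      · subst l0
        have r0 : r ≠ .nil := by
          rintro rfl
          simp [nVertices] at hv
        obtain rfl : b = true := by simpa [r0] using hr
        exact .inl ⟨r, ⟨by simpa [nVertices] using hv, her⟩, rfl⟩
      by_cases r0 : r = .nil
      · subst r0
        obtain rfl : b = false := by simpa [l0] using hl
        exact .inl ⟨l, ⟨by simpa [nVertices] using hv, hel⟩, rfl⟩
      have hl' := mt nVertices_eq_zero.1 l0
      have hr' := mt nVertices_eq_zero.1 r0
      exact .inr ⟨nVertices l - 1, by omega, l, r, ⟨by omega, hel⟩, ⟨by omega, her⟩, rfl⟩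
  · rintro (⟨u, ⟨hv, he⟩, rfl⟩ | ⟨k, hk, l, r, ⟨hl, hel⟩, ⟨hr, her⟩, rfl⟩)
    · cases b <;> simp_all [graft, nVertices, hasErasAux]
    · have l0 : l ≠ .nil := by
        rintro rfl
        simp [nVertices] at hl
      have r0 : r ≠ .nil := by
        rintro rfl
        simp [nVertices] at hr
      exact ⟨by simp only [nVertices]; omega, by simp [hasErasAux, l0, r0, hel, her]⟩

open Classical in
/-- The trees with `n + 1` vertices which, attached to a parent on a given side, have no erasable
vertex form a finite set with `motzkin n` elements. -/
theorem exists_finset_reduced (n : ℕ) (b : Bool) :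
    ∃ s : Finset BTree, (∀ t, t ∈ s ↔ nVertices t = n + 1 ∧ ¬ hasErasAux b t) ∧
      s.card = motzkin n := by
  induction n using Nat.strong_induction_on generalizing b with
  | _ n ih =>
  cases n with
  | zero =>
    refine ⟨{.node .nil .nil}, fun t => ?_, by simp [motzkin]⟩
    cases t with
    | nil => simp [nVertices]
    | node l r =>
      simp only [Finset.mem_singleton, BTree.node.injEq, nVertices, zero_add,
        Nat.add_eq_right, Nat.add_eq_zero_iff, nVertices_eq_zero]
      constructor
      · rintro ⟨rfl, rfl⟩
        simp [hasErasAux]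
      · exact fun h => h.1
  | succ n =>
    choose! s hs hc using ih
    refine ⟨(s n (!b)).image (graft b) ∪ (Finset.range n).biUnion fun k =>
      (s k true ×ˢ s (n - 1 - k) false).image fun p => BTree.node p.1 p.2, fun t => ?_, ?_⟩
    · rw [mem_reduced_succ_iff]
      simp only [Finset.mem_union, Finset.mem_image, Finset.mem_biUnion, Finset.mem_range,
        Finset.mem_product, Prod.exists]
      refine or_congr (exists_congr fun u => by rw [hs n (by omega)])
        (exists_congr fun k => and_congr_right fun hk =>
          exists_congr fun l => exists_congr fun r => ?_)
      rw [hs k (by omega), hs (n - 1 - k) (by omega), and_assoc]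
    · rw [Finset.card_union_of_disjoint, Finset.card_biUnion,
        Finset.card_image_of_injective _ (graft_injective b), hc n (by omega), motzkin_succ]
      · congr 1
        refine Finset.sum_congr rfl fun k hk => ?_
        have hk := Finset.mem_range.1 hk
        rw [Finset.card_image_of_injective, Finset.card_product, hc k (by omega),
          hc (n - 1 - k) (by omega)]
        rintro ⟨l, r⟩ ⟨l', r'⟩ h
        simpa using h
      · intro i hi j hj hij
        have hi := Finset.mem_range.1 hi
        have hj := Finset.mem_range.1 hj
        rw [Function.onFun, Finset.disjoint_left]
        simp only [Finset.mem_image, Finset.mem_product, Prod.exists]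
        rintro _ ⟨l, r, ⟨hl, -⟩, rfl⟩ ⟨l', r', ⟨hl', -⟩, h⟩
        obtain ⟨rfl, rfl⟩ := BTree.node.inj h
        have h₁ := ((hs i (by omega) _ _).1 hl).1
        have h₂ := ((hs j (by omega) _ _).1 hl').1
        omega
      · rw [Finset.disjoint_left]
        simp only [Finset.mem_image, Finset.mem_biUnion, Finset.mem_range, Finset.mem_product,
          Prod.exists]
        rintro _ ⟨u, -, rfl⟩ ⟨k, hk, l, r, ⟨hl, hr⟩, h⟩
        have h₁ := ((hs k (by omega) _ _).1 hl).1
        have h₂ := ((hs (n - 1 - k) (by omega) _ _).1 hr).1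
        cases b <;> obtain ⟨rfl, rfl⟩ := BTree.node.inj h <;> simp [nVertices] at h₁ h₂

/-- A right-planted tree has no erasable vertex exactly when the right subtree of its root has none
as a right child. -/
theorem rightPlanted_reduced_iff (n : ℕ) (t : BTree) :
    (RightPlanted t ∧ nEdges t = n + 1 ∧ ¬ HasErasable t) ↔
      ∃ r, (nVertices r = n + 1 ∧ ¬ hasErasAux false r) ∧ graft true r = t := by
  constructor
  · rintro ⟨hp, hn, he⟩
    cases t with
    | nil => exact hp.elim
    | node l r =>
      obtain ⟨rfl, -⟩ := hp
      exact ⟨r, ⟨by simpa [nEdges, nVertices] using hn, fun h => he (.inr h)⟩, rfl⟩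
  · rintro ⟨r, ⟨hn, he⟩, rfl⟩
    refine ⟨⟨rfl, ?_⟩, by simpa [graft, nEdges, nVertices] using hn, ?_⟩
    · rintro rfl
      simp [nVertices] at hn
    · rintro (h | h)
      exacts [h, he h]

/-- For every `n ≥ 0`, the number of right-planted binary
trees with `n + 1` edges and no erasable vertex is the Motzkin number `M_n`. -/
theorem stmt_14 (n : ℕ) :
    Nat.card {t : BTree // RightPlanted t ∧ nEdges t = n + 1 ∧ ¬ HasErasable t} =
      motzkin n := by
  obtain ⟨s, hs, hc⟩ := exists_finset_reduced n false
  rw [← hc, ← Finset.card_map ⟨graft true, graft_injective true⟩]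
  refine Nat.subtype_card _ fun t => ?_
  rw [rightPlanted_reduced_iff]
  simp [hs]

end Paper
end

section
/- The map sending an ordered pair (A, B) of nonempty Dyck paths to the concatenation A U B D is a bijection from the set of such pairs onto the set of Dyck paths that end with DD and contain an occurrence of DUU whose downstep ends at height 0; this map sends a pair with sizes (a, b) to a Dyck path of size a + b + 1. -/
namespace Paper

/-- `p` contains an occurrence of `DUU` whose downstep ends at height 0. -/
def GroundDUU (p : List Step) : Prop :=
  ∃ j : ℕ, (p.drop j).take 3 = [D, U, U] ∧
    (p.take (j + 1)).count U = (p.take (j + 1)).count D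

theorem step_eq (x : Step) : x = U ∨ x = D := by
  cases x
  · exact Or.inr rfl
  · exact Or.inl rfl

@[simp] theorem count_U_cons_U (p : List Step) : (U :: p).count U = p.count U + 1 := by
  simp [U]

@[simp] theorem count_D_cons_U (p : List Step) : (U :: p).count D = p.count D := by
  simp [U, D]

@[simp] theorem count_U_cons_D (p : List Step) : (D :: p).count U = p.count U := by
  simp [U, D]

@[simp] theorem count_D_cons_D (p : List Step) : (D :: p).count D = p.count D + 1 := by
  simp [D]

theorem IsDyck.append {A B : List Step} (hA : IsDyck A) (hB : IsDyck B) :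
    IsDyck (A ++ B) := by
  refine ⟨by simp [hA.1, hB.1], fun n => ?_⟩
  have h₁ := hA.2 n
  have h₂ := hB.2 (n - A.length)
  simp only [List.take_append, List.count_append]
  omega

theorem IsDyck.wrap {B : List Step} (hB : IsDyck B) : IsDyck (U :: (B ++ [D])) := by
  refine ⟨by simp [hB.1], fun n => ?_⟩
  cases n with
  | zero => simp
  | succ n =>
    have h₁ := hB.2 n
    have h₂ : ([D].take (n - B.length)).count D ≤ 1 :=
      List.count_le_length.trans (by simp)
    simp only [List.take_succ_cons, List.take_append, List.count_append,
      count_U_cons_U, count_D_cons_U]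
    omega

theorem IsDyck.exists_eq_append_D {p : List Step} (hp : IsDyck p) (hne : p ≠ []) :
    ∃ q, p = q ++ [D] := by
  obtain ⟨q, x, rfl⟩ := List.eq_nil_or_concat p |>.resolve_left hne
  obtain rfl | rfl := step_eq x
  · have h₁ := hp.1
    have h₂ := hp.2 q.length
    simp at h₁ h₂
    omega
  · exact ⟨q, by simp⟩

theorem IsDyck.exists_eq_U_cons {p : List Step} (hp : IsDyck p) (hne : p ≠ []) :
    ∃ q, p = U :: q := by
  obtain ⟨x, q, rfl⟩ := List.exists_cons_of_ne_nil hne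
  obtain rfl | rfl := step_eq x
  · exact ⟨q, rfl⟩
  · have h := hp.2 1
    simp at h

/-- After `A`, the path `A U B D` returns to ground level only at its end. -/
theorem count_take_lt_of_length_lt {A B : List Step} (hA : IsDyck A) (hB : IsDyck B)
    {m : ℕ} (h₁ : A.length < m) (h₂ : m ≤ A.length + B.length + 1) :
    ((A ++ [U] ++ B ++ [D]).take m).count D < ((A ++ [U] ++ B ++ [D]).take m).count U := by
  obtain ⟨k, rfl⟩ : ∃ k, m = A.length + (k + 1) := ⟨m - A.length - 1, by omega⟩
  have hk : k ≤ B.length := by omega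
  have h := hB.2 k
  have hA' := hA.1
  simp only [List.append_assoc, List.take_length_add_append, List.nil_append,
    List.cons_append, List.take_succ_cons, List.take_append_of_le_length hk,
    List.count_append, count_U_cons_U, count_D_cons_U]
  omega

theorem length_le_of_append_eq {A B A' B' : List Step} (hA : IsDyck A) (hB : IsDyck B)
    (hA' : IsDyck A') (h : A ++ [U] ++ B ++ [D] = A' ++ [U] ++ B' ++ [D]) :
    A'.length ≤ A.length := by
  by_contra! hlt
  have hlen := congrArg List.length h
  simp at hlen
  have hc := count_take_lt_of_length_lt hA hB hlt (by omega)
  rw [h] at hc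
  simp only [List.append_assoc, List.take_left] at hc
  exact absurd hA'.1 (by omega)

theorem groundDUU_append {A B : List Step} (hA : IsDyck A) (hA₀ : A ≠ [])
    (hB : IsDyck B) (hB₀ : B ≠ []) : GroundDUU (A ++ [U] ++ B ++ [D]) := by
  obtain ⟨A, rfl⟩ := hA.exists_eq_append_D hA₀
  obtain ⟨B, rfl⟩ := hB.exists_eq_U_cons hB₀
  refine ⟨A.length, by simp, ?_⟩
  have h := hA.1
  simpa [List.take_length_add_append] using h

theorem exists_eq_append_of_groundDUU {p : List Step} (hp : IsDyck p) (hDD : EndsDD p)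
    (hG : GroundDUU p) :
    ∃ A B, IsDyck A ∧ A ≠ [] ∧ IsDyck B ∧ B ≠ [] ∧ A ++ [U] ++ B ++ [D] = p := by
  obtain ⟨q, rfl⟩ := hDD
  obtain ⟨j, hj, hj₀⟩ := hG
  have hjl := congrArg List.length hj
  simp only [List.length_take, List.length_drop, List.length_append, List.length_cons,
    List.length_nil] at hjl
  set P : ℕ → Prop := fun m =>
    ((q ++ [D, D]).take m).count U = ((q ++ [D, D]).take m).count D with hP
  have hbal := hp.1
  simp only [List.count_append, count_U_cons_D, count_D_cons_D, List.count_nil] at hbal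
  obtain ⟨m, hm, hmq, hjm, hmax⟩ : ∃ m, P m ∧ m ≤ q.length + 1 ∧ j + 1 ≤ m ∧
      ∀ k, m < k → k ≤ q.length + 1 → ¬ P k := by
    classical
    exact ⟨Nat.findGreatest P (q.length + 1),
      Nat.findGreatest_spec (P := P) (m := j + 1) (by omega) hj₀, Nat.findGreatest_le _,
      Nat.le_findGreatest (by omega) hj₀, fun k h₁ h₂ => Nat.findGreatest_is_greatest h₁ h₂⟩
  have hmlt : m < q.length := by
    by_contra! hle
    obtain rfl | rfl : m = q.length ∨ m = q.length + 1 := by omega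
    · simp [hP] at hm
      omega
    · simp [hP, List.take_length_add_append] at hm
      omega
  obtain ⟨A, x, C, rfl, rfl⟩ : ∃ A x C, q = A ++ x :: C ∧ A.length = m :=
    ⟨q.take m, q[m], q.drop (m + 1), by simp, by simp; omega⟩
  simp only [hP, List.append_assoc, List.take_left] at hm
  have hA : IsDyck A := by
    refine ⟨hm, fun n => ?_⟩
    have h := hp.2 (min n A.length)
    rw [List.append_assoc, List.take_append_of_le_length (by omega)] at h
    rwa [List.take_eq_take_min]
  have hx : x = U := by
    obtain rfl | rfl := step_eq x
    · rfl
    · have h := hp.2 (A.length + 1)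
      simp only [List.append_assoc, List.take_length_add_append, List.cons_append,
        List.take_succ_cons, List.take_zero, List.count_append, count_U_cons_D,
        count_D_cons_D, List.count_nil] at h
      omega
  subst hx
  simp only [List.count_append, count_U_cons_U, count_D_cons_U] at hbal
  refine ⟨A, C ++ [D], hA, ?_, ⟨?_, fun n => ?_⟩, by simp, by simp⟩
  · rintro rfl
    simp at hjm
  · simp
    omega
  · rcases le_or_gt n C.length with hn | hn
    · have h₁ := hp.2 (A.length + (n + 1))
      have h₂ := hmax (A.length + (n + 1)) (by omega) (by simp; omega)
      simp only [hP, List.append_assoc, List.take_length_add_append, List.cons_append,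
        List.take_succ_cons, List.count_append, count_U_cons_U, count_D_cons_U,
        List.take_append_of_le_length hn] at h₁ h₂ ⊢
      omega
    · rw [List.take_of_length_le (by simp; omega)]
      simp
      omega

/-- The map `(A, B) ↦ A U B D` is a bijection from pairs of
nonempty Dyck paths onto Dyck paths that end `DD` and contain a ground-level
`DUU`; it sends sizes `(a, b)` to size `a + b + 1`. -/
theorem stmt_17 :
    Set.BijOn (fun q : List Step × List Step => q.1 ++ [U] ++ q.2 ++ [D])
      {q : List Step × List Step |
        IsDyck q.1 ∧ q.1 ≠ [] ∧ IsDyck q.2 ∧ q.2 ≠ []}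
      {p : List Step | IsDyck p ∧ EndsDD p ∧ GroundDUU p} ∧
    ∀ A B : List Step,
      (A ++ [U] ++ B ++ [D]).count U = A.count U + B.count U + 1 := by
  refine ⟨⟨?_, ?_, ?_⟩, fun A B => ?_⟩
  · rintro ⟨A, B⟩ ⟨hA, hA₀, hB, hB₀⟩
    refine ⟨by simpa using hA.append hB.wrap, ?_, groundDUU_append hA hA₀ hB hB₀⟩
    obtain ⟨C, hC⟩ := hB.exists_eq_append_D hB₀
    exact ⟨A ++ [U] ++ C, by simp_all⟩
  · rintro ⟨A, B⟩ ⟨hA, -, hB, -⟩ ⟨A', B'⟩ ⟨hA', -, hB', -⟩ h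
    dsimp only at hA hB hA' hB' h
    have hlen : A.length = A'.length :=
      le_antisymm (length_le_of_append_eq hA' hB' hA h.symm)
        (length_le_of_append_eq hA hB hA' h)
    simp only [List.append_assoc] at h
    obtain ⟨rfl, h⟩ := List.append_inj h hlen
    simpa using h
  · rintro p ⟨hp, hDD, hG⟩
    obtain ⟨A, B, hA, hA₀, hB, hB₀, h⟩ := exists_eq_append_of_groundDUU hp hDD hG
    exact ⟨(A, B), ⟨hA, hA₀, hB, hB₀⟩, h⟩
  · simp
    omega

end Paper
end
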